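/- Let T be a locally satisfiable negative local theory and κ > |L| a cardinal. Then every κ-ultrahomogeneous local model of T is κ-saturated, and conversely every κ-saturated local positively closed model of T is κ-ultrahomogeneous for T. -/

import Mathlib

noncomputable section

structure LocalLanguage : Type 1 where
  Sorts : Type
  Rel : (n : ℕ) → (Fin n → Sorts) → Type
  Const : Sorts → Type
  Loc : Sorts → Type
  locToRel : {s : Sorts} → Loc s → Rel 2 ![s, s]
  dd0 : (s : Sorts) → Loc s
  locMul : {s : Sorts} → Loc s → Loc s → Loc s
  locLe : {s : Sorts} → Loc s → Loc s → Prop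
  locMul_assoc : ∀ {s} (d₁ d₂ d₃ : Loc s), locMul (locMul d₁ d₂) d₃ = locMul d₁ (locMul d₂ d₃)
  dd0_locMul : ∀ {s} (d : Loc s), locMul (dd0 s) d = d
  locMul_dd0 : ∀ {s} (d : Loc s), locMul d (dd0 s) = d
  locLe_refl : ∀ {s} (d : Loc s), locLe d d
  locLe_trans : ∀ {s} (d₁ d₂ d₃ : Loc s), locLe d₁ d₂ → locLe d₂ d₃ → locLe d₁ d₃
  locLe_antisymm : ∀ {s} (d₁ d₂ : Loc s), locLe d₁ d₂ → locLe d₂ d₁ → d₁ = d₂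
  dd0_locLe : ∀ {s} (d : Loc s), locLe (dd0 s) d
  locMul_mono : ∀ {s} (d₁ d₂ e₁ e₂ : Loc s), locLe d₁ e₁ → locLe d₂ e₂ →
    locLe (locMul d₁ d₂) (locMul e₁ e₂)
  bound : {s : Sorts} → Const s → Const s → Loc s

structure LStructure (L : LocalLanguage) : Type 1 where
  Dom : L.Sorts → Type
  relMap : {n : ℕ} → {ρ : Fin n → L.Sorts} → L.Rel n ρ → ((i : Fin n) → Dom (ρ i)) → Prop
  constMap : {s : L.Sorts} → L.Const s → Dom s

def dpair {C : Fin 2 → Sort*} (a : C 0) (b : C 1) : (i : Fin 2) → C i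
  | ⟨0, _⟩ => a
  | ⟨1, _⟩ => b

def LStructure.locRel {L : LocalLanguage} (M : LStructure L) {s : L.Sorts}
    (d : L.Loc s) (a b : M.Dom s) : Prop :=
  M.relMap (L.locToRel d) (dpair a b)

structure IsLocal {L : LocalLanguage} (M : LStructure L) : Prop where
  symm : ∀ {s : L.Sorts} (d : L.Loc s) (a b : M.Dom s), M.locRel d a b → M.locRel d b a
  mono : ∀ {s : L.Sorts} (d₁ d₂ : L.Loc s), L.locLe d₁ d₂ →
    ∀ (a b : M.Dom s), M.locRel d₁ a b → M.locRel d₂ a b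
  comp : ∀ {s : L.Sorts} (d₁ d₂ : L.Loc s) (a b c : M.Dom s),
    M.locRel d₁ a b → M.locRel d₂ b c → M.locRel (L.locMul d₁ d₂) a c
  boundAx : ∀ {s : L.Sorts} (c₁ c₂ : L.Const s),
    M.locRel (L.bound c₁ c₂) (M.constMap c₁) (M.constMap c₂)
  total : ∀ {s : L.Sorts} (a b : M.Dom s), ∃ d : L.Loc s, M.locRel d a b
  dd0_eq : ∀ {s : L.Sorts} (a b : M.Dom s), M.locRel (L.dd0 s) a b ↔ a = b

/-! ## Syntax -/

/-- Terms: variables or constants (the language is relational). -/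
inductive LTerm (L : LocalLanguage) (α : Type) (σ : α → L.Sorts) : L.Sorts → Type
  | var (a : α) : LTerm L α σ (σ a)
  | const {s : L.Sorts} (c : L.Const s) : LTerm L α σ s

/-- Sort assignment for a context extended by one variable of sort `s`. -/
abbrev osort {L : LocalLanguage} {α : Type} (s : L.Sorts) (σ : α → L.Sorts) :
    Option α → L.Sorts :=
  fun o => Option.elim o s σ

/-- Positive formulas: atomic, conjunction, disjunction, existential quantification. -/
inductive PosForm (L : LocalLanguage) : (α : Type) → (α → L.Sorts) → Type 1
  | rel {α : Type} {σ : α → L.Sorts} {n : ℕ} {ρ : Fin n → L.Sorts}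
      (R : L.Rel n ρ) (ts : (i : Fin n) → LTerm L α σ (ρ i)) : PosForm L α σ
  | and {α : Type} {σ : α → L.Sorts} (φ ψ : PosForm L α σ) : PosForm L α σ
  | or {α : Type} {σ : α → L.Sorts} (φ ψ : PosForm L α σ) : PosForm L α σ
  | ex {α : Type} {σ : α → L.Sorts} (s : L.Sorts)
      (φ : PosForm L (Option α) (osort s σ)) : PosForm L α σ

/-- Local positive formulas: atomic, conjunction, disjunction, local existential
quantification `∃ x ∈ d(t) φ`. -/
inductive LPosForm (L : LocalLanguage) : (α : Type) → (α → L.Sorts) → Type 1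
  | rel {α : Type} {σ : α → L.Sorts} {n : ℕ} {ρ : Fin n → L.Sorts}
      (R : L.Rel n ρ) (ts : (i : Fin n) → LTerm L α σ (ρ i)) : LPosForm L α σ
  | and {α : Type} {σ : α → L.Sorts} (φ ψ : LPosForm L α σ) : LPosForm L α σ
  | or {α : Type} {σ : α → L.Sorts} (φ ψ : LPosForm L α σ) : LPosForm L α σ
  | lex {α : Type} {σ : α → L.Sorts} (s : L.Sorts) (d : L.Loc s) (t : LTerm L α σ s)
      (φ : LPosForm L (Option α) (osort s σ)) : LPosForm L α σ

/-- Local formulas: atomic, negation, conjunction, local existential quantification. -/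
inductive LForm (L : LocalLanguage) : (α : Type) → (α → L.Sorts) → Type 1
  | rel {α : Type} {σ : α → L.Sorts} {n : ℕ} {ρ : Fin n → L.Sorts}
      (R : L.Rel n ρ) (ts : (i : Fin n) → LTerm L α σ (ρ i)) : LForm L α σ
  | not {α : Type} {σ : α → L.Sorts} (φ : LForm L α σ) : LForm L α σ
  | and {α : Type} {σ : α → L.Sorts} (φ ψ : LForm L α σ) : LForm L α σ
  | lex {α : Type} {σ : α → L.Sorts} (s : L.Sorts) (d : L.Loc s) (t : LTerm L α σ s)
      (φ : LForm L (Option α) (osort s σ)) : LForm L α σ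

/-! ## Semantics -/

def LTerm.realize {L : LocalLanguage} (M : LStructure L) {α : Type} {σ : α → L.Sorts}
    (v : (a : α) → M.Dom (σ a)) : {s : L.Sorts} → LTerm L α σ s → M.Dom s
  | _, .var a => v a
  | _, .const c => M.constMap c

/-- Extension of a valuation by a value for the new variable. -/
def vcons {L : LocalLanguage} {M : LStructure L} {α : Type} {σ : α → L.Sorts} {s : L.Sorts}
    (x : M.Dom s) (v : (a : α) → M.Dom (σ a)) : (o : Option α) → M.Dom (osort s σ o)
  | none => x
  | some a => v a

def PosForm.Realize {L : LocalLanguage} (M : LStructure L) :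
    {α : Type} → {σ : α → L.Sorts} → PosForm L α σ → ((a : α) → M.Dom (σ a)) → Prop
  | _, _, .rel R ts, v => M.relMap R (fun i => (ts i).realize M v)
  | _, _, .and φ ψ, v => φ.Realize M v ∧ ψ.Realize M v
  | _, _, .or φ ψ, v => φ.Realize M v ∨ ψ.Realize M v
  | _, _, .ex s φ, v => ∃ x : M.Dom s, φ.Realize M (vcons x v)

def LPosForm.Realize {L : LocalLanguage} (M : LStructure L) :
    {α : Type} → {σ : α → L.Sorts} → LPosForm L α σ → ((a : α) → M.Dom (σ a)) → Prop
  | _, _, .rel R ts, v => M.relMap R (fun i => (ts i).realize M v)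
  | _, _, .and φ ψ, v => φ.Realize M v ∧ ψ.Realize M v
  | _, _, .or φ ψ, v => φ.Realize M v ∨ ψ.Realize M v
  | _, _, .lex s d t φ, v =>
      ∃ x : M.Dom s, M.locRel d x (t.realize M v) ∧ φ.Realize M (vcons x v)

def LForm.Realize {L : LocalLanguage} (M : LStructure L) :
    {α : Type} → {σ : α → L.Sorts} → LForm L α σ → ((a : α) → M.Dom (σ a)) → Prop
  | _, _, .rel R ts, v => M.relMap R (fun i => (ts i).realize M v)
  | _, _, .not φ, v => ¬ φ.Realize M v
  | _, _, .and φ ψ, v => φ.Realize M v ∧ ψ.Realize M v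
  | _, _, .lex s d t φ, v =>
      ∃ x : M.Dom s, M.locRel d x (t.realize M v) ∧ φ.Realize M (vcons x v)

/-- Quantifier-free positive formulas. -/
inductive PosForm.IsQF {L : LocalLanguage} : {α : Type} → {σ : α → L.Sorts} → PosForm L α σ → Prop
  | rel {α : Type} {σ : α → L.Sorts} {n : ℕ} {ρ : Fin n → L.Sorts}
      (R : L.Rel n ρ) (ts : (i : Fin n) → LTerm L α σ (ρ i)) : PosForm.IsQF (.rel R ts)
  | and {α : Type} {σ : α → L.Sorts} {φ ψ : PosForm L α σ} :
      PosForm.IsQF φ → PosForm.IsQF ψ → PosForm.IsQF (.and φ ψ)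
  | or {α : Type} {σ : α → L.Sorts} {φ ψ : PosForm L α σ} :
      PosForm.IsQF φ → PosForm.IsQF ψ → PosForm.IsQF (.or φ ψ)


/-! ## Sentences, theories, models -/

/-- Sort assignment for the empty context. -/
abbrev emptySorts (L : LocalLanguage) : Empty → L.Sorts := fun e => e.elim

/-- Positive sentences. -/
abbrev PosSentence (L : LocalLanguage) := PosForm L Empty (emptySorts L)

/-- A positive sentence holds in a structure. -/
def PosSentence.RealizedIn {L : LocalLanguage} (φ : PosSentence L) (M : LStructure L) : Prop :=
  φ.Realize M (fun e => e.elim)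

/-- We represent a negative theory by the set of positive sentences whose negations
belong to it.  `M` is a local model of `T` if `M` is local and satisfies the negation of
every positive sentence in `T`. -/
def LocalModel {L : LocalLanguage} (M : LStructure L) (T : Set (PosSentence L)) : Prop :=
  IsLocal M ∧ ∀ φ ∈ T, ¬ φ.RealizedIn M

/-- `T` (a set of positive sentences standing for the negative theory `{¬φ : φ ∈ T}`)
is a negative local theory if it is closed under local implication: any negative sentence
true in every local model of `T` is already in `T`. -/
def IsNegLocalTheory {L : LocalLanguage} (T : Set (PosSentence L)) : Prop :=
  ∀ φ : PosSentence L, (∀ M : LStructure L, LocalModel M T → ¬ φ.RealizedIn M) → φ ∈ T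

/-- `T` is locally satisfiable: it has a local model. -/
def LocSat {L : LocalLanguage} (T : Set (PosSentence L)) : Prop :=
  ∃ M : LStructure L, LocalModel M T

/-- The negative theory of a structure (as the set of positive sentences failing in it). -/
def ThNeg {L : LocalLanguage} (M : LStructure L) : Set (PosSentence L) :=
  {φ | ¬ φ.RealizedIn M}

/-! ## Homomorphisms -/

structure LHom {L : LocalLanguage} (M N : LStructure L) where
  toFun : (s : L.Sorts) → M.Dom s → N.Dom s
  map_rel : ∀ {n : ℕ} {ρ : Fin n → L.Sorts} (R : L.Rel n ρ) (x : (i : Fin n) → M.Dom (ρ i)),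
    M.relMap R x → N.relMap R (fun i => toFun (ρ i) (x i))
  map_const : ∀ {s : L.Sorts} (c : L.Const s), toFun s (M.constMap c) = N.constMap c

def LHom.comp {L : LocalLanguage} {M N P : LStructure L} (g : LHom N P) (f : LHom M N) :
    LHom M P where
  toFun s := g.toFun s ∘ f.toFun s
  map_rel R x h := g.map_rel R _ (f.map_rel R x h)
  map_const c := by
    simp only [Function.comp_apply, f.map_const, g.map_const]

def LHom.id {L : LocalLanguage} (M : LStructure L) : LHom M M where
  toFun _ := fun x => x
  map_rel _ _ h := h
  map_const _ := rfl

/-- A homomorphism is a positive embedding if it reflects all positive formulas. -/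
def LHom.IsPosEmbedding {L : LocalLanguage} {M N : LStructure L} (h : LHom M N) : Prop :=
  ∀ (α : Type) (σ : α → L.Sorts) (φ : PosForm L α σ) (v : (a : α) → M.Dom (σ a)),
    φ.Realize N (fun a => h.toFun (σ a) (v a)) → φ.Realize M v

/-- A local positively closed model of `T`. -/
def IsPC {L : LocalLanguage} (M : LStructure L) (T : Set (PosSentence L)) : Prop :=
  LocalModel M T ∧
    ∀ (N : LStructure L) (h : LHom M N), LocalModel N T → h.IsPosEmbedding

/-- An endomorphism is an automorphism if it has a two-sided inverse homomorphism. -/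
def LHom.IsAuto {L : LocalLanguage} {M : LStructure L} (f : LHom M M) : Prop :=
  ∃ g : LHom M M, g.comp f = LHom.id M ∧ f.comp g = LHom.id M

/-- Isomorphism of structures. -/
def Isomorphic {L : LocalLanguage} (M N : LStructure L) : Prop :=
  ∃ (f : LHom M N) (g : LHom N M), g.comp f = LHom.id M ∧ f.comp g = LHom.id N

/-! ## Types -/

/-- The local positive type of a tuple. -/
def ltp {L : LocalLanguage} (M : LStructure L) {α : Type} {σ : α → L.Sorts}
    (v : (a : α) → M.Dom (σ a)) : Set (LPosForm L α σ) :=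
  {φ | φ.Realize M v}

/-- The positive type of a tuple. -/
def ptp {L : LocalLanguage} (M : LStructure L) {α : Type} {σ : α → L.Sorts}
    (v : (a : α) → M.Dom (σ a)) : Set (PosForm L α σ) :=
  {φ | φ.Realize M v}

/-- A partial local positive type of `T` on `(α, σ)`: a set of local positive formulas
realized by some tuple in some local model of `T`. -/
def IsPartialLType {L : LocalLanguage} (T : Set (PosSentence L)) {α : Type}
    {σ : α → L.Sorts} (Γ : Set (LPosForm L α σ)) : Prop :=
  ∃ (M : LStructure L) (v : (a : α) → M.Dom (σ a)),
    LocalModel M T ∧ ∀ φ ∈ Γ, LPosForm.Realize M φ v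

/-- A local positive type: a maximal partial local positive type. -/
def IsLType {L : LocalLanguage} (T : Set (PosSentence L)) {α : Type}
    {σ : α → L.Sorts} (Γ : Set (LPosForm L α σ)) : Prop :=
  IsPartialLType T Γ ∧ ∀ Γ' : Set (LPosForm L α σ), IsPartialLType T Γ' → Γ ⊆ Γ' → Γ' = Γ

/-- A variable `(α, σ)` is pointed if every sort not occurring among its sorts carries a
constant symbol. -/
def VPointed {L : LocalLanguage} {α : Type} (σ : α → L.Sorts) : Prop :=
  ∀ s : L.Sorts, s ∉ Set.range σ → Nonempty (L.Const s)


/-! ## Bounds and bounded satisfiability -/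

/-- Pair of terms as arguments for a binary relation symbol. -/
def tpair {L : LocalLanguage} {α : Type} {σ : α → L.Sorts} {s t : L.Sorts}
    (t₁ : LTerm L α σ s) (t₂ : LTerm L α σ t) : (i : Fin 2) → LTerm L α σ (![s, t] i) :=
  dpair t₁ t₂

/-- A bound of the variable `(α, σ)`: a choice, for every single variable whose sort
carries a constant symbol, of a locality relation and a constant, and for every pair of
single variables of the same sort, of a locality relation. -/
structure VBound (L : LocalLanguage) (α : Type) (σ : α → L.Sorts) where
  dConst : (a : α) → Nonempty (L.Const (σ a)) → L.Loc (σ a)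
  cConst : (a : α) → Nonempty (L.Const (σ a)) → L.Const (σ a)
  dPair : (a b : α) → σ a = σ b → L.Loc (σ a)

/-- The set of (atomic, quantifier-free) local positive formulas making up a bound:
`d_a(x_a, c_a)` and `d_{a,b}(x_a, x_b)`. -/
def VBound.toSet {L : LocalLanguage} {α : Type} {σ : α → L.Sorts} (B : VBound L α σ) :
    Set (LPosForm L α σ) :=
  {φ | (∃ (a : α) (h : Nonempty (L.Const (σ a))),
          φ = LPosForm.rel (L.locToRel (B.dConst a h))
                (tpair (LTerm.var a) (LTerm.const (B.cConst a h)))) ∨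
       (∃ (a b : α) (e : σ a = σ b),
          φ = LPosForm.rel (L.locToRel (B.dPair a b e))
                (tpair (LTerm.var a) (e.symm ▸ LTerm.var b)))}

/-- A bound holds of a tuple if all its formulas do. -/
def VBound.Holds {L : LocalLanguage} {α : Type} {σ : α → L.Sorts} (B : VBound L α σ)
    (M : LStructure L) (v : (a : α) → M.Dom (σ a)) : Prop :=
  ∀ ψ ∈ B.toSet, LPosForm.Realize M ψ v

/-- Finite local satisfiability of a set of local positive formulas in `T`. -/
def FinLocSat {L : LocalLanguage} (T : Set (PosSentence L)) {α : Type} {σ : α → L.Sorts}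
    (Δ : Set (LPosForm L α σ)) : Prop :=
  ∀ Δ₀ ⊆ Δ, Δ₀.Finite →
    ∃ (M : LStructure L) (v : (a : α) → M.Dom (σ a)),
      LocalModel M T ∧ ∀ φ ∈ Δ₀, LPosForm.Realize M φ v

/-- Bounded satisfiability: for some bound `B`, `Γ ∪ B` is finitely locally satisfiable. -/
def BoundedlySat {L : LocalLanguage} (T : Set (PosSentence L)) {α : Type}
    {σ : α → L.Sorts} (Γ : Set (LPosForm L α σ)) : Prop :=
  ∃ B : VBound L α σ, FinLocSat T (Γ ∪ B.toSet)

/-! ## Π₁-local formulas -/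

/-- Dependent `Sum.elim` of valuations. -/
def sval {L : LocalLanguage} {M : LStructure L} {α β : Type} {σ : α → L.Sorts}
    {τ : β → L.Sorts} (v : (a : α) → M.Dom (σ a)) (w : (b : β) → M.Dom (τ b)) :
    (x : α ⊕ β) → M.Dom (Sum.elim σ τ x)
  | .inl a => v a
  | .inr b => w b

/-- A Π₁-local formula: a universally quantified local formula. -/
structure Pi1LForm (L : LocalLanguage) (α : Type) (σ : α → L.Sorts) : Type 1 where
  n : ℕ
  τ : Fin n → L.Sorts
  matrix : LForm L (α ⊕ Fin n) (Sum.elim σ τ)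

def Pi1LForm.Realize {L : LocalLanguage} {α : Type} {σ : α → L.Sorts}
    (φ : Pi1LForm L α σ) (M : LStructure L) (v : (a : α) → M.Dom (σ a)) : Prop :=
  ∀ w : (i : Fin φ.n) → M.Dom (φ.τ i), φ.matrix.Realize M (sval v w)

/-- Bounded satisfiability of a set of Π₁-local formulas: for some bound `B`, every
finite subset of `Γ` together with every finite part of `B` is realized in a local
model of `T`. -/
def Pi1BoundedlySat {L : LocalLanguage} (T : Set (PosSentence L)) {α : Type}
    {σ : α → L.Sorts} (Γ : Set (Pi1LForm L α σ)) : Prop :=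
  ∃ B : VBound L α σ,
    ∀ Γ₀ ⊆ Γ, Γ₀.Finite → ∀ F ⊆ B.toSet, F.Finite →
      ∃ (M : LStructure L) (v : (a : α) → M.Dom (σ a)),
        LocalModel M T ∧ (∀ φ ∈ Γ₀, Pi1LForm.Realize φ M v) ∧
          (∀ ψ ∈ F, LPosForm.Realize M ψ v)

/-! ## Cardinality, homogeneity, retractors -/

/-- The cardinality of a structure: that of the disjoint union of its sorts. -/
def LStructure.card {L : LocalLanguage} (M : LStructure L) : Cardinal :=
  Cardinal.mk (Σ s : L.Sorts, M.Dom s)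

/-- The cardinality of a local language. -/
def LocalLanguage.card (L : LocalLanguage) : Cardinal :=
  max Cardinal.aleph0
    (Cardinal.mk (L.Sorts ⊕ (Σ s : L.Sorts, L.Const s) ⊕ (Σ s : L.Sorts, L.Loc s) ⊕
      (Σ (n : ℕ) (ρ : Fin n → L.Sorts), L.Rel n ρ)))

/-- `M` is a (local positively) κ-ultrahomogeneous model of `T`. -/
def IsUltrahomogeneous {L : LocalLanguage} (T : Set (PosSentence L)) (M : LStructure L)
    (κ : Cardinal) : Prop :=
  ∀ A B : LStructure L, LocalModel A T → LocalModel B T → A.card < κ → B.card < κ →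
    ∀ f : LHom A M, f.IsPosEmbedding → ∀ g : LHom A B, ∃ h : LHom B M, h.comp g = f

/-- A retractor of `T`: a local model of `T` such that every homomorphism into a local
model of `T` has a retraction. -/
def IsRetractor {L : LocalLanguage} (T : Set (PosSentence L)) (C : LStructure L) : Prop :=
  LocalModel C T ∧
    ∀ N : LStructure L, LocalModel N T →
      ∀ f : LHom C N, ∃ g : LHom N C, g.comp f = LHom.id C

/-- `M` is κ-universal for a class `K` of structures. -/
def IsUniversal {L : LocalLanguage} (M : LStructure L) (K : LStructure L → Prop)
    (κ : Cardinal) : Prop :=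
  ∀ N : LStructure L, K N → N.card < κ → Nonempty (LHom N M)

/-- `M` is absolutely universal for a class `K` of structures. -/
def IsAbsUniversal {L : LocalLanguage} (M : LStructure L) (K : LStructure L → Prop) : Prop :=
  ∀ N : LStructure L, K N → Nonempty (LHom N M)

/-- Compatibility of two local models of `T`. -/
def Compat {L : LocalLanguage} (T : Set (PosSentence L)) (A B : LStructure L) : Prop :=
  ∃ M : LStructure L, LocalModel M T ∧ Nonempty (LHom A M) ∧ Nonempty (LHom B M)

/-- The local joint (homomorphism) property. -/
def HasLJP {L : LocalLanguage} (T : Set (PosSentence L)) : Prop :=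
  ∀ A B : LStructure L, LocalModel A T → LocalModel B T →
    ∃ M : LStructure L, LocalModel M T ∧ Nonempty (LHom A M) ∧ Nonempty (LHom B M)


/-! ## Parameters -/

/-- A set of parameters in a structure. -/
def ParamSet {L : LocalLanguage} (M : LStructure L) := (s : L.Sorts) → Set (M.Dom s)

/-- Interpretation in `M` of old and new constants of the expanded language. -/
def paramInterp {L : LocalLanguage} (M : LStructure L) (A : ParamSet M) {s : L.Sorts} :
    L.Const s ⊕ (A s) → M.Dom s
  | .inl c => M.constMap c
  | .inr a => a.1

/-- The expansion `L(A)` of `L` by new constants for the parameters `A` of a local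
structure `M`; bounds for pairs involving the new constants are chosen (by locality
axiom (A5)) so that they hold in `M`. -/
noncomputable def LocalLanguage.withParams (L : LocalLanguage) (M : LStructure L)
    (hM : IsLocal M) (A : ParamSet M) : LocalLanguage where
  Sorts := L.Sorts
  Rel := L.Rel
  Const s := L.Const s ⊕ (A s)
  Loc := L.Loc
  locToRel := L.locToRel
  dd0 := L.dd0
  locMul := L.locMul
  locLe := L.locLe
  locMul_assoc := L.locMul_assoc
  dd0_locMul := L.dd0_locMul
  locMul_dd0 := L.locMul_dd0
  locLe_refl := L.locLe_refl
  locLe_trans := L.locLe_trans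
  locLe_antisymm := L.locLe_antisymm
  dd0_locLe := L.dd0_locLe
  locMul_mono := L.locMul_mono
  bound := fun {_s} c₁ c₂ =>
    match c₁, c₂ with
    | .inl c₁, .inl c₂ => L.bound c₁ c₂
    | c₁, c₂ => Classical.choose (hM.total (paramInterp M A c₁) (paramInterp M A c₂))

/-- The natural expansion `M_A` of `M` to an `L(A)`-structure. -/
noncomputable def LStructure.withParams {L : LocalLanguage} (M : LStructure L)
    (hM : IsLocal M) (A : ParamSet M) : LStructure (L.withParams M hM A) where
  Dom := M.Dom
  relMap := M.relMap
  constMap := paramInterp M A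

/-- `M` has the local joint property over `A`: any two local models of `Th₋(M/A)` map
into a common local model of `Th₋(M/A)`. -/
def HasLJPOver {L : LocalLanguage} (M : LStructure L) (hM : IsLocal M) (A : ParamSet M) :
    Prop :=
  HasLJP (ThNeg (M.withParams hM A))

/-- `M` is (local positively) κ-saturated: it realizes every local positive type of
`Th₋(M/A)` on `x` whenever `|x| < κ`, `|A| < κ` and `M` has the local joint property
over `A`. -/
def IsSaturatedAt {L : LocalLanguage} (M : LStructure L) (hM : IsLocal M)
    (κ : Cardinal) : Prop :=
  ∀ A : ParamSet M, Cardinal.mk (Σ s : L.Sorts, A s) < κ → HasLJPOver M hM A →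
    ∀ (α : Type) (σ : α → L.Sorts), Cardinal.mk α < κ →
      ∀ Γ : Set (LPosForm (L.withParams M hM A) α σ),
        IsLType (ThNeg (M.withParams hM A)) Γ →
          ∃ v : (a : α) → M.Dom (σ a), ∀ φ ∈ Γ, LPosForm.Realize (M.withParams hM A) φ v

/-- The local positive type of a tuple over a set of parameters `A`, rendered as the set
of local positive formulas with extra free variables for the parameters of `A` that are
satisfied when those variables are evaluated at the parameters themselves. -/
def ltpOver {L : LocalLanguage} (M : LStructure L) (A : ParamSet M) {α : Type}
    {σ : α → L.Sorts} (v : (a : α) → M.Dom (σ a)) :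
    Set (LPosForm L (α ⊕ Σ s : L.Sorts, A s) (Sum.elim σ (fun p => p.1))) :=
  {φ | φ.Realize M (sval v (fun p => p.2.1))}

/-! ## Substructures -/

/-- A substructure of `M`: a family of subsets closed under the constants (the language
is relational). -/
structure Substruct {L : LocalLanguage} (M : LStructure L) where
  carrier : (s : L.Sorts) → Set (M.Dom s)
  const_mem : ∀ {s : L.Sorts} (c : L.Const s), M.constMap c ∈ carrier s

/-- The induced structure on a substructure. -/
def Substruct.toStruct {L : LocalLanguage} {M : LStructure L} (A : Substruct M) :
    LStructure L where
  Dom s := A.carrier s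
  relMap R x := M.relMap R (fun i => (x i).1)
  constMap c := ⟨M.constMap c, A.const_mem c⟩


/-! ## Topologies -/

/-- The `d`-ball at `a`. -/
def LStructure.ball {L : LocalLanguage} (M : LStructure L) {s : L.Sorts} (d : L.Loc s)
    (a : M.Dom s) : Set (M.Dom s) :=
  {b | M.locRel d a b}

/-- The local positive logic topology on a single sort of `M`: closed sets are the
subsets defined by sets of local positive formulas with parameters in `M` (parameters
being rendered as extra free variables evaluated at themselves). -/
def lpTopologyS {L : LocalLanguage} (M : LStructure L) (s : L.Sorts) :
    TopologicalSpace (M.Dom s) :=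
  TopologicalSpace.generateFrom
    {U | ∃ φ : LPosForm L (Unit ⊕ Σ s' : L.Sorts, M.Dom s')
            (Sum.elim (fun _ => s) (fun p => p.1)),
      U = {x | ¬ LPosForm.Realize M φ (sval (fun _ => x) (fun p => p.2))}}

/-- The space of local positive types of `T` on the variable `(α, σ)`. -/
def LTypeSpace (L : LocalLanguage) (T : Set (PosSentence L)) (α : Type)
    (σ : α → L.Sorts) :=
  {Γ : Set (LPosForm L α σ) // IsLType T Γ}

/-- The local positive logic topology on the space of local positive types: generated by
declaring `⟨φ⟩ = {p : φ ∈ p}` closed for every local positive formula `φ`; its closed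
sets are then exactly the sets `⟨Γ⟩` together with `∅`. -/
instance {L : LocalLanguage} (T : Set (PosSentence L)) (α : Type) (σ : α → L.Sorts) :
    TopologicalSpace (LTypeSpace L T α σ) :=
  TopologicalSpace.generateFrom
    {U | ∃ φ : LPosForm L α σ, U = {p : LTypeSpace L T α σ | φ ∉ p.1}}

/-! ## Completeness and compactness -/

/-- `T` is complete: `T = Th₋(M)` for every local positively closed model `M` of `T`. -/
def IsCompleteTheory {L : LocalLanguage} (T : Set (PosSentence L)) : Prop :=
  ∀ M : LStructure L, IsPC M T → ThNeg M = T

/-- `T` is local positively compact. -/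
def IsLocPosCompact {L : LocalLanguage} (T : Set (PosSentence L)) : Prop :=
  ∀ (s : L.Sorts) (γ : Type), Finite γ →
    ∀ (τ : γ → L.Sorts) (φ : LPosForm L (Fin 2 ⊕ γ) (Sum.elim (fun _ => s) τ)),
      (∀ M : LStructure L, LocalModel M T →
        ∀ (a : M.Dom s) (w : (j : γ) → M.Dom (τ j)),
          ¬ LPosForm.Realize M φ (sval ![a, a] w)) →
      ∀ (B : VBound L (Unit ⊕ γ) (Sum.elim (fun _ => s) τ)) (d : L.Loc s),
        ∃ k : ℕ, 0 < k ∧ ∀ M : LStructure L, LocalModel M T →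
          ¬ ∃ (a : Fin k → M.Dom s) (w : (j : γ) → M.Dom (τ j)),
            ∀ i j : Fin k, i ≠ j →
              B.Holds M (sval (fun _ => a i) w) ∧ M.locRel d (a i) (a j) ∧
                LPosForm.Realize M φ (sval ![a i, a j] w)

/-! ## Homomorphisms and realization -/

theorem dpair_map {C D : Fin 2 → Type} (f : (i : Fin 2) → C i → D i) (a : C 0) (b : C 1) :
    (fun i => f i (dpair a b i)) = dpair (f 0 a) (f 1 b) := by
  funext i
  match i with
  | ⟨0, _⟩ => rfl
  | ⟨1, _⟩ => rfl

theorem LHom.map_locRel {L : LocalLanguage} {M N : LStructure L} (h : LHom M N) {s : L.Sorts}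
    {d : L.Loc s} {a b : M.Dom s} (hab : M.locRel d a b) :
    N.locRel d (h.toFun s a) (h.toFun s b) := by
  have := h.map_rel _ _ hab
  rwa [dpair_map (D := fun i => N.Dom (![s, s] i)) (fun i => h.toFun (![s, s] i)) a b] at this

theorem realize_tpair {L : LocalLanguage} (M : LStructure L) {α : Type} {σ : α → L.Sorts}
    (v : (a : α) → M.Dom (σ a)) {s t : L.Sorts} (t₁ : LTerm L α σ s) (t₂ : LTerm L α σ t) :
    (fun i => (tpair t₁ t₂ i).realize M v) =
      dpair (C := fun i => M.Dom (![s, t] i)) (t₁.realize M v) (t₂.realize M v) :=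
  dpair_map (D := fun i => M.Dom (![s, t] i))
    (fun i (u : LTerm L α σ (![s, t] i)) => u.realize M v) t₁ t₂

theorem LHom.realize_term {L : LocalLanguage} {M N : LStructure L} (h : LHom M N) {α : Type}
    {σ : α → L.Sorts} (v : (a : α) → M.Dom (σ a)) {s : L.Sorts} (t : LTerm L α σ s) :
    t.realize N (fun a => h.toFun (σ a) (v a)) = h.toFun s (t.realize M v) := by
  cases t with
  | var a => rfl
  | const c => exact (h.map_const c).symm

theorem vcons_map {L : LocalLanguage} {M N : LStructure L} (f : (s : L.Sorts) → M.Dom s → N.Dom s)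
    {α : Type} {σ : α → L.Sorts} {s : L.Sorts} (x : M.Dom s) (v : (a : α) → M.Dom (σ a)) :
    vcons (M := N) (f s x) (fun a => f (σ a) (v a)) =
      fun o => f (osort s σ o) (vcons x v o) := by
  funext o
  cases o <;> rfl

/-! ## Substitution and positive translations -/

/-- Substitution of terms for variables in a term. -/
def LTerm.subst {L : LocalLanguage} {α β : Type} {σ : α → L.Sorts} {τ : β → L.Sorts}
    (θ : (a : α) → LTerm L β τ (σ a)) : {s : L.Sorts} → LTerm L α σ s → LTerm L β τ s
  | _, .var a => θ a
  | _, .const c => .const c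

/-- Weakening of a term to a context with one more variable. -/
def LTerm.weaken {L : LocalLanguage} {α : Type} {σ : α → L.Sorts} (r : L.Sorts) {s : L.Sorts}
    (t : LTerm L α σ s) : LTerm L (Option α) (osort r σ) s :=
  t.subst (τ := osort r σ) (fun a => LTerm.var (σ := osort r σ) (some a))

theorem LTerm.realize_weaken {L : LocalLanguage} (M : LStructure L) {α : Type}
    {σ : α → L.Sorts} {r : L.Sorts} (x : M.Dom r) (v : (a : α) → M.Dom (σ a)) {s : L.Sorts}
    (t : LTerm L α σ s) : (t.weaken r).realize M (vcons x v) = t.realize M v := by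
  cases t <;> rfl

/-- The variable bound by a quantifier. -/
def LTerm.bound {L : LocalLanguage} {α : Type} {σ : α → L.Sorts} (r : L.Sorts) :
    LTerm L (Option α) (osort r σ) r :=
  LTerm.var (σ := osort r σ) none

/-- Extension of a substitution under a quantifier. -/
def substCons {L : LocalLanguage} {α β : Type} {σ : α → L.Sorts} {τ : β → L.Sorts}
    (r : L.Sorts) (θ : (a : α) → LTerm L β τ (σ a)) :
    (o : Option α) → LTerm L (Option β) (osort r τ) (osort r σ o)
  | none => LTerm.bound r
  | some a => (θ a).weaken r

theorem realize_substCons {L : LocalLanguage} (M : LStructure L) {α β : Type} {σ : α → L.Sorts}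
    {τ : β → L.Sorts} {r : L.Sorts} (θ : (a : α) → LTerm L β τ (σ a)) (x : M.Dom r)
    (w : (b : β) → M.Dom (τ b)) :
    (fun o => (substCons r θ o).realize M (vcons x w)) =
      vcons x (fun a => (θ a).realize M w) := by
  funext o
  cases o with
  | none => rfl
  | some a => exact (θ a).realize_weaken M x w

/-- Substitution of terms for the free variables of a positive formula. -/
def PosForm.subst {L : LocalLanguage} : {α : Type} → {σ : α → L.Sorts} → PosForm L α σ →
    {β : Type} → {τ : β → L.Sorts} → ((a : α) → LTerm L β τ (σ a)) → PosForm L β τ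
  | _, _, .rel R ts, _, _, θ => .rel R (fun i => (ts i).subst θ)
  | _, _, .and φ ψ, _, _, θ => .and (φ.subst θ) (ψ.subst θ)
  | _, _, .or φ ψ, _, _, θ => .or (φ.subst θ) (ψ.subst θ)
  | _, _, .ex s φ, _, _, θ => .ex s (φ.subst (substCons s θ))

theorem LTerm.realize_subst {L : LocalLanguage} (M : LStructure L) {α β : Type}
    {σ : α → L.Sorts} {τ : β → L.Sorts} (θ : (a : α) → LTerm L β τ (σ a))
    (w : (b : β) → M.Dom (τ b)) {s : L.Sorts} (t : LTerm L α σ s) :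
    (t.subst θ).realize M w = t.realize M (fun a => (θ a).realize M w) := by
  cases t <;> rfl

theorem PosForm.realize_subst {L : LocalLanguage} (M : LStructure L) {α : Type}
    {σ : α → L.Sorts} (φ : PosForm L α σ) {β : Type} {τ : β → L.Sorts}
    (θ : (a : α) → LTerm L β τ (σ a)) (w : (b : β) → M.Dom (τ b)) :
    (φ.subst θ).Realize M w ↔ φ.Realize M (fun a => (θ a).realize M w) := by
  induction φ generalizing β with
  | rel R ts => simp only [PosForm.subst, PosForm.Realize, LTerm.realize_subst]
  | and φ ψ ih₁ ih₂ => exact and_congr (ih₁ θ w) (ih₂ θ w)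
  | or φ ψ ih₁ ih₂ => exact or_congr (ih₁ θ w) (ih₂ θ w)
  | ex s φ ih =>
    refine exists_congr fun x => ?_
    rw [ih, realize_substCons]

/-- A local positive formula, viewed as a positive formula. -/
def LPosForm.toPosForm {L : LocalLanguage} : {α : Type} → {σ : α → L.Sorts} → LPosForm L α σ →
    PosForm L α σ
  | _, _, .rel R ts => .rel R ts
  | _, _, .and φ ψ => .and φ.toPosForm ψ.toPosForm
  | _, _, .or φ ψ => .or φ.toPosForm ψ.toPosForm
  | _, _, .lex s d t φ =>
      .ex s (.and (.rel (L.locToRel d)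
        (tpair (LTerm.bound s) (t.weaken s))) φ.toPosForm)

theorem LPosForm.realize_toPosForm {L : LocalLanguage} (M : LStructure L) {α : Type}
    {σ : α → L.Sorts} (φ : LPosForm L α σ) (v : (a : α) → M.Dom (σ a)) :
    φ.toPosForm.Realize M v ↔ φ.Realize M v := by
  induction φ with
  | rel R ts => rfl
  | and φ ψ ih₁ ih₂ => exact and_congr (ih₁ v) (ih₂ v)
  | or φ ψ ih₁ ih₂ => exact or_congr (ih₁ v) (ih₂ v)
  | lex s d t φ ih =>
    refine exists_congr fun x => and_congr ?_ (ih _)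
    simp only [PosForm.Realize]
    rw [realize_tpair, LTerm.realize_weaken]
    rfl

/-! ## Downward Löwenheim–Skolem for positive formulas -/

/-- The one-sorted first-order language with the relation symbols and constants of `L`. -/
def LocalLanguage.oneSorted (L : LocalLanguage) : FirstOrder.Language.{0, 0} where
  Functions n := {_c : Σ s : L.Sorts, L.Const s // n = 0}
  Relations n := Σ ρ : Fin n → L.Sorts, L.Rel n ρ

theorem LocalLanguage.card_oneSorted_le (L : LocalLanguage) : L.oneSorted.card ≤ L.card := by
  refine le_trans ?_ (le_max_right _ _)
  refine Cardinal.mk_le_of_injective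
    (f := fun
      | .inl f => .inr (.inl f.2.1)
      | .inr r => .inr (.inr (.inr ⟨r.1, r.2.1, r.2.2⟩))) ?_
  rintro (⟨n, f, hf⟩ | ⟨n, ρ, R⟩) (⟨m, g, hg⟩ | ⟨m, ρ', R'⟩) h
  · subst hf hg
    simp only [Sum.inr.injEq, Sum.inl.injEq] at h
    subst h
    rfl
  · simp at h
  · simp at h
  · simp only [Sum.inr.injEq, Sigma.mk.injEq] at h
    obtain ⟨rfl, h⟩ := h
    simp only [heq_eq_eq, Sigma.mk.injEq] at h
    obtain ⟨rfl, h⟩ := h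
    simp only [heq_eq_eq] at h
    subst h
    rfl

/-- The one-sorted structure on the disjoint union of the sorts. -/
@[reducible]
def LStructure.oneSorted {L : LocalLanguage} (P : LStructure L) :
    L.oneSorted.Structure (Σ s : L.Sorts, P.Dom s) where
  funMap f _ := ⟨f.1.1, P.constMap f.1.2⟩
  RelMap r t := ∃ x : (i : Fin _) → P.Dom (r.1 i), (∀ i, t i = ⟨r.1 i, x i⟩) ∧ P.relMap r.2 x

/-- The relation symbol of the one-sorted language given by a relation symbol of `L`. -/
def LocalLanguage.oneSortedRel (L : LocalLanguage) {n : ℕ} {ρ : Fin n → L.Sorts}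
    (R : L.Rel n ρ) : L.oneSorted.Relations n :=
  ⟨ρ, R⟩

/-- Translation of terms to the one-sorted language. -/
def LTerm.oneSorted {L : LocalLanguage} {α : Type} {σ : α → L.Sorts} :
    {s : L.Sorts} → LTerm L α σ s → L.oneSorted.Term α
  | _, .var a => .var a
  | s, .const c => .func (l := 0) (⟨⟨s, c⟩, rfl⟩ : L.oneSorted.Functions 0) Fin.elim0

theorem LTerm.realize_oneSorted {L : LocalLanguage} (P : LStructure L) {α : Type}
    {σ : α → L.Sorts} (v : (a : α) → P.Dom (σ a)) {s : L.Sorts} (t : LTerm L α σ s) :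
    letI := P.oneSorted
    t.oneSorted.realize (fun a => (⟨σ a, v a⟩ : Σ s, P.Dom s)) = ⟨s, t.realize P v⟩ := by
  cases t <;> rfl

theorem LStructure.relMap_oneSorted {L : LocalLanguage} (P : LStructure L) {n : ℕ}
    {ρ : Fin n → L.Sorts} (R : L.Rel n ρ) (x : (i : Fin n) → P.Dom (ρ i)) :
    letI := P.oneSorted
    FirstOrder.Language.Structure.RelMap (L.oneSortedRel R) (fun i => (⟨ρ i, x i⟩ : Σ s, P.Dom s)) ↔
        P.relMap R x := by
  constructor
  · rintro ⟨y, hy, h⟩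
    have : x = y := funext fun i => eq_of_heq (Sigma.mk.inj (hy i)).2
    rwa [this]
  · exact fun h => ⟨x, fun _ => rfl, h⟩

/-- The formula of the one-sorted language expressing that its variable has sort `s`. -/
def LocalLanguage.sortFormula (L : LocalLanguage) {α : Type} (s : L.Sorts) (a : α) :
    L.oneSorted.Formula α :=
  FirstOrder.Language.Relations.formula
    (L.oneSortedRel (L.locToRel (L.dd0 s))) (fun _ => .var a)

theorem realize_sortFormula {L : LocalLanguage} {P : LStructure L} (hP : IsLocal P) {α : Type}
    (s : L.Sorts) (a : α) (v : α → Σ s, P.Dom s) :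
    letI := P.oneSorted
    (L.sortFormula s a).Realize v ↔ ∃ y : P.Dom s, v a = ⟨s, y⟩ := by
  let := P.oneSorted
  rw [LocalLanguage.sortFormula, FirstOrder.Language.Formula.realize_rel]
  constructor
  · rintro ⟨x, hx, -⟩
    exact ⟨x 0, hx 0⟩
  · rintro ⟨y, hy⟩
    refine ⟨dpair (C := fun i => P.Dom (![s, s] i)) y y, ?_, (hP.dd0_eq y y).2 rfl⟩
    intro i
    match i with
    | ⟨0, _⟩ => exact hy
    | ⟨1, _⟩ => exact hy

theorem PosForm.exists_oneSorted {L : LocalLanguage} {P : LStructure L} (hP : IsLocal P)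
    {α : Type} {σ : α → L.Sorts} (φ : PosForm L α σ) :
    letI := P.oneSorted
    ∃ ψ : L.oneSorted.Formula α, ∀ v : (a : α) → P.Dom (σ a),
      ψ.Realize (fun a => (⟨σ a, v a⟩ : Σ s, P.Dom s)) ↔ φ.Realize P v := by
  let := P.oneSorted
  induction φ with
  | @rel α σ n ρ R ts =>
    refine ⟨FirstOrder.Language.Relations.formula (L.oneSortedRel R)
      (fun i => (ts i).oneSorted), fun v => ?_⟩
    rw [FirstOrder.Language.Formula.realize_rel]
    simp only [LTerm.realize_oneSorted]
    exact P.relMap_oneSorted R _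
  | and φ ψ ih₁ ih₂ =>
    obtain ⟨φ', h₁⟩ := ih₁
    obtain ⟨ψ', h₂⟩ := ih₂
    refine ⟨φ' ⊓ ψ', fun v => ?_⟩
    rw [FirstOrder.Language.Formula.realize_inf, h₁, h₂]
    rfl
  | or φ ψ ih₁ ih₂ =>
    obtain ⟨φ', h₁⟩ := ih₁
    obtain ⟨ψ', h₂⟩ := ih₂
    refine ⟨φ' ⊔ ψ', fun v => ?_⟩
    rw [FirstOrder.Language.Formula.realize_sup, h₁, h₂]
    rfl
  | @ex α σ s φ ih =>
    obtain ⟨φ', h⟩ := ih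
    let e : Option α → α ⊕ Unit := fun o => o.elim (.inr ()) .inl
    refine ⟨FirstOrder.Language.Formula.iExs Unit ((φ' ⊓ L.sortFormula s none).relabel e),
      fun v => ?_⟩
    rw [FirstOrder.Language.Formula.realize_iExs]
    have key : ∀ x : P.Dom s, (Sum.elim (fun a => (⟨σ a, v a⟩ : Σ s, P.Dom s))
        (fun _ : Unit => ⟨s, x⟩)) ∘ e = fun o => ⟨osort s σ o, vcons x v o⟩ := by
      intro x
      funext o
      cases o <;> rfl
    constructor
    · rintro ⟨i, hi⟩
      rw [FirstOrder.Language.Formula.realize_relabel, FirstOrder.Language.Formula.realize_inf,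
        realize_sortFormula hP] at hi
      obtain ⟨hi, y, hy⟩ := hi
      have hi' : i = fun _ => ⟨s, y⟩ := funext fun _ => hy
      rw [hi', key, h] at hi
      exact ⟨y, hi⟩
    · rintro ⟨x, hx⟩
      refine ⟨fun _ => ⟨s, x⟩, ?_⟩
      rw [FirstOrder.Language.Formula.realize_relabel, FirstOrder.Language.Formula.realize_inf,
        key, h, realize_sortFormula hP]
      exact ⟨hx, x, rfl⟩

theorem Substruct.realize_term {L : LocalLanguage} {P : LStructure L} (B : Substruct P)
    {α : Type} {σ : α → L.Sorts} (v : (a : α) → B.toStruct.Dom (σ a)) {s : L.Sorts}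
    (t : LTerm L α σ s) :
    t.realize P (fun a => (v a).1) = (t.realize B.toStruct v).1 := by
  cases t <;> rfl

theorem exists_small_positive_substruct {L : LocalLanguage} {P : LStructure L} (hP : IsLocal P)
    {κ : Cardinal} (hκ : L.card < κ) (S₀ : Set (Σ s, P.Dom s)) (hS₀ : Cardinal.mk S₀ < κ) :
    ∃ B : Substruct P, (∀ p ∈ S₀, p.2 ∈ B.carrier p.1) ∧ B.toStruct.card < κ ∧
      ∀ (α : Type) (σ : α → L.Sorts) (φ : PosForm L α σ)
        (v : (a : α) → B.toStruct.Dom (σ a)),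
        φ.Realize P (fun a => (v a).1) ↔ φ.Realize B.toStruct v := by
  let := P.oneSorted
  obtain ⟨S, hS₀S, hS⟩ : ∃ S : L.oneSorted.ElementarySubstructure (Σ s, P.Dom s),
      S₀ ⊆ S ∧ Cardinal.mk S < κ := by
    by_cases h : max (Cardinal.mk S₀) L.card ≤ Cardinal.mk (Σ s, P.Dom s)
    · obtain ⟨S, h₁, h₂⟩ := FirstOrder.Language.exists_elementarySubstructure_card_eq
        L.oneSorted S₀ (max (Cardinal.mk S₀) L.card)
        (le_trans (le_max_left _ _) (le_max_right _ L.card))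
        (by simp) (by simpa using Or.inr L.card_oneSorted_le) (by simpa using h)
      refine ⟨S, h₁, ?_⟩
      rw [Cardinal.lift_id, Cardinal.lift_id] at h₂
      rw [h₂]
      exact max_lt hS₀ hκ
    · refine ⟨⊤, fun _ _ => trivial, ?_⟩
      refine lt_of_le_of_lt (Cardinal.mk_le_of_injective Subtype.val_injective) ?_
      exact (not_le.1 h).trans (max_lt hS₀ hκ)
  let B : Substruct P :=
    { carrier := fun s => {x | (⟨s, x⟩ : Σ s, P.Dom s) ∈ S}
      const_mem := fun {s} c =>
        S.toSubstructure.fun_mem (n := 0) (⟨⟨s, c⟩, rfl⟩ : L.oneSorted.Functions 0) Fin.elim0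
          (fun i => i.elim0) }
  refine ⟨B, fun p hp => hS₀S hp, ?_, ?_⟩
  · refine lt_of_le_of_lt (Cardinal.mk_le_of_injective
      (f := fun p : Σ s, B.toStruct.Dom s => (⟨⟨p.1, p.2.1⟩, p.2.2⟩ : S)) ?_) hS
    rintro ⟨s, x, hx⟩ ⟨t, y, hy⟩ h
    have h' := congrArg Subtype.val h
    simp only [Sigma.mk.injEq] at h'
    obtain ⟨rfl, h'⟩ := h'
    obtain rfl := eq_of_heq h'
    rfl
  · intro α σ φ v
    induction φ with
    | rel R ts =>
      simp only [PosForm.Realize, Substruct.realize_term]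
      rfl
    | and φ ψ ih₁ ih₂ => exact and_congr (ih₁ v) (ih₂ v)
    | or φ ψ ih₁ ih₂ => exact or_congr (ih₁ v) (ih₂ v)
    | @ex α σ s φ ih =>
      have hv : ∀ x : B.toStruct.Dom s, (vcons (M := P) x.1 fun a => (v a).1) =
          fun o => (vcons x v o).1 := by
        intro x
        funext o
        cases o <;> rfl
      constructor
      · intro hex
        obtain ⟨φ', hφ'⟩ := φ.exists_oneSorted hP
        let e : Option α → α ⊕ Unit := fun o => o.elim (.inr ()) .inl
        let χ := FirstOrder.Language.Formula.iExs Unit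
          ((φ' ⊓ L.sortFormula s none).relabel e)
        let w : α → S := fun a => ⟨⟨σ a, (v a).1⟩, (v a).2⟩
        have hχ : χ.Realize (S.subtype ∘ w) := by
          obtain ⟨x, hx⟩ := hex
          rw [FirstOrder.Language.Formula.realize_iExs]
          refine ⟨fun _ => ⟨s, x⟩, ?_⟩
          rw [FirstOrder.Language.Formula.realize_relabel,
            FirstOrder.Language.Formula.realize_inf, realize_sortFormula hP]
          refine ⟨?_, x, rfl⟩
          rw [← hφ'] at hx
          convert hx using 1
          funext o
          cases o <;> rfl
        rw [S.subtype.map_formula, FirstOrder.Language.Formula.realize_iExs] at hχ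
        obtain ⟨i, hi⟩ := hχ
        rw [FirstOrder.Language.Formula.realize_relabel, ← S.subtype.map_formula,
          FirstOrder.Language.Formula.realize_inf, realize_sortFormula hP] at hi
        obtain ⟨hi, y, hy⟩ := hi
        have hy' : (i ()).1 = (⟨s, y⟩ : Σ s, P.Dom s) := hy
        have hyS : y ∈ B.carrier s := by
          change (⟨s, y⟩ : Σ s, P.Dom s) ∈ S
          rw [← hy']
          exact (i ()).2
        let z : B.toStruct.Dom s := ⟨y, hyS⟩
        refine ⟨z, (ih (vcons z v)).1 ?_⟩
        rw [← hv z, ← hφ']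
        convert hi using 1
        funext o
        cases o with
        | none => exact hy'.symm
        | some a => rfl
      · rintro ⟨x, hx⟩
        refine ⟨x.1, ?_⟩
        rw [hv]
        exact (ih _).2 hx

/-! ## Bounded ultraproducts -/

section BoundedProduct

/-- A family of structures indexed by a set with an ultrafilter, together with a set of base
points of the product, containing the constants and pairwise at bounded distance. -/
structure BasedFamily (L : LocalLanguage) where
  Idx : Type
  ultra : Ultrafilter Idx
  str : Idx → LStructure L
  isLocal : ∀ i, IsLocal (str i)
  base : (s : L.Sorts) → Set ((i : Idx) → (str i).Dom s)
  const_mem : ∀ {s : L.Sorts} (c : L.Const s), (fun i => (str i).constMap c) ∈ base s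
  base_bounded : ∀ {s : L.Sorts}, ∀ b ∈ base s, ∀ b' ∈ base s,
    ∃ d : L.Loc s, ∀ᶠ i in ultra, (str i).locRel d (b i) (b' i)

namespace BasedFamily

variable {L : LocalLanguage} (F : BasedFamily L)

/-- An element of the product is bounded if it is at bounded distance from a base point. -/
def Bounded {s : L.Sorts} (f : (i : F.Idx) → (F.str i).Dom s) : Prop :=
  ∃ b ∈ F.base s, ∃ d : L.Loc s, ∀ᶠ i in F.ultra, (F.str i).locRel d (f i) (b i)

variable {F}

theorem Bounded.congr {s : L.Sorts} {f g : (i : F.Idx) → (F.str i).Dom s} (hf : F.Bounded f)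
    (h : ∀ᶠ i in F.ultra, f i = g i) : F.Bounded g := by
  obtain ⟨b, hb, d, hd⟩ := hf
  refine ⟨b, hb, d, ?_⟩
  filter_upwards [hd, h] with i hi hfg
  rwa [← hfg]

theorem bounded_of_mem_base {s : L.Sorts} {b : (i : F.Idx) → (F.str i).Dom s}
    (hb : b ∈ F.base s) : F.Bounded b :=
  ⟨b, hb, L.dd0 s, Filter.Eventually.of_forall fun i => ((F.isLocal i).dd0_eq _ _).2 rfl⟩

theorem Bounded.of_locRel {s : L.Sorts} {f g : (i : F.Idx) → (F.str i).Dom s}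
    (hg : F.Bounded g) {d : L.Loc s} (h : ∀ᶠ i in F.ultra, (F.str i).locRel d (f i) (g i)) :
    F.Bounded f := by
  obtain ⟨b, hb, e, he⟩ := hg
  refine ⟨b, hb, L.locMul d e, ?_⟩
  filter_upwards [h, he] with i h₁ h₂ using (F.isLocal i).comp _ _ _ _ _ h₁ h₂

theorem mk_out_eventuallyEq {s : L.Sorts} (f : (i : F.Idx) → (F.str i).Dom s) :
    ∀ᶠ i in F.ultra, f i =
      (Quotient.mk (Filter.productSetoid (F.ultra : Filter F.Idx) _) f).out i :=
  @Setoid.symm _ (Filter.productSetoid (F.ultra : Filter F.Idx) _) _ _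
    (Quotient.mk_out (s := Filter.productSetoid (F.ultra : Filter F.Idx) _) f)

variable (F)

/-- The bounded ultraproduct of a based family: its points are the classes of bounded elements
of the product. -/
def prod : LStructure L where
  Dom s := {q : Quotient (Filter.productSetoid (F.ultra : Filter F.Idx)
    fun i => (F.str i).Dom s) // F.Bounded q.out}
  relMap R x := ∀ᶠ i in F.ultra, (F.str i).relMap R (fun k => (x k).1.out i)
  constMap c := ⟨Quotient.mk _ (fun i => (F.str i).constMap c),
    (bounded_of_mem_base (F.const_mem c)).congr (mk_out_eventuallyEq _)⟩

variable {F}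

/-- A chosen representative of a point of the bounded ultraproduct. -/
def rep {s : L.Sorts} (x : F.prod.Dom s) : (i : F.Idx) → (F.str i).Dom s :=
  Quotient.out (Subtype.val x)

/-- The point of the bounded ultraproduct given by a bounded element of the product. -/
def point {s : L.Sorts} (f : (i : F.Idx) → (F.str i).Dom s) (hf : F.Bounded f) : F.prod.Dom s :=
  ⟨Quotient.mk _ f, hf.congr (mk_out_eventuallyEq f)⟩

theorem rep_point {s : L.Sorts} (f : (i : F.Idx) → (F.str i).Dom s) (hf : F.Bounded f) :
    ∀ᶠ i in F.ultra, rep (point f hf) i = f i :=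
  (mk_out_eventuallyEq f).mono fun _ => Eq.symm

theorem rep_constMap {s : L.Sorts} (c : L.Const s) :
    ∀ᶠ i in F.ultra, rep (F.prod.constMap c) i = (F.str i).constMap c :=
  rep_point _ (bounded_of_mem_base (F.const_mem c))

theorem bounded_rep {s : L.Sorts} (x : F.prod.Dom s) : F.Bounded (rep x) := x.2

theorem ext_of_eventually {s : L.Sorts} {x y : F.prod.Dom s}
    (h : ∀ᶠ i in F.ultra, rep x i = rep y i) : x = y := by
  refine Subtype.ext ?_
  rw [← Quotient.out_eq (Subtype.val x), ← Quotient.out_eq (Subtype.val y)]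
  exact Quotient.sound (s := Filter.productSetoid (F.ultra : Filter F.Idx) _) h

theorem locRel_prod {s : L.Sorts} {d : L.Loc s} {x y : F.prod.Dom s} :
    F.prod.locRel d x y ↔ ∀ᶠ i in F.ultra, (F.str i).locRel d (rep x i) (rep y i) := by
  refine iff_of_eq (congrArg (fun p => Filter.Eventually p (F.ultra : Filter F.Idx)) ?_)
  funext i
  exact congrArg _ (dpair_map (C := fun k => F.prod.Dom (![s, s] k))
    (D := fun k => (F.str i).Dom (![s, s] k)) (fun k z => rep z i) x y)

variable (F)

theorem isLocal_prod : IsLocal F.prod where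
  symm d a b h := by
    rw [locRel_prod] at h ⊢
    filter_upwards [h] with i hi using (F.isLocal i).symm _ _ _ hi
  mono d₁ d₂ hd a b h := by
    rw [locRel_prod] at h ⊢
    filter_upwards [h] with i hi using (F.isLocal i).mono _ _ hd _ _ hi
  comp d₁ d₂ a b c h₁ h₂ := by
    rw [locRel_prod] at h₁ h₂ ⊢
    filter_upwards [h₁, h₂] with i h₁ h₂ using (F.isLocal i).comp _ _ _ _ _ h₁ h₂
  boundAx c₁ c₂ := by
    rw [locRel_prod]
    filter_upwards [rep_constMap c₁,
      rep_constMap c₂] with i h₁ h₂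
    have := (F.isLocal i).boundAx c₁ c₂
    rw [← h₁, ← h₂] at this
    exact this
  total a b := by
    obtain ⟨b₁, hb₁, d₁, h₁⟩ := bounded_rep a
    obtain ⟨b₂, hb₂, d₂, h₂⟩ := bounded_rep b
    obtain ⟨e, he⟩ := F.base_bounded b₁ hb₁ b₂ hb₂
    refine ⟨L.locMul (L.locMul d₁ e) d₂, ?_⟩
    rw [locRel_prod]
    filter_upwards [h₁, h₂, he] with i h₁ h₂ he
    exact (F.isLocal i).comp _ _ _ _ _ ((F.isLocal i).comp _ _ _ _ _ h₁ he)
      ((F.isLocal i).symm _ _ _ h₂)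
  dd0_eq a b := by
    rw [locRel_prod]
    constructor
    · intro h
      exact ext_of_eventually (h.mono fun i hi => ((F.isLocal i).dd0_eq _ _).1 hi)
    · rintro rfl
      exact Filter.Eventually.of_forall fun i => ((F.isLocal i).dd0_eq _ _).2 rfl

variable {F} {α : Type} {σ : α → L.Sorts}

/-- The family `u` of elements of the factors represents the tuple `v` of the product. -/
def Represents (u : (i : F.Idx) → (a : α) → (F.str i).Dom (σ a))
    (v : (a : α) → F.prod.Dom (σ a)) : Prop :=
  ∀ a, ∀ᶠ i in F.ultra, rep (v a) i = u i a

theorem represents_rep (v : (a : α) → F.prod.Dom (σ a)) :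
    Represents (fun i a => rep (v a) i) v :=
  fun _ => Filter.Eventually.of_forall fun _ => rfl

theorem Represents.realize_term {u : (i : F.Idx) → (a : α) → (F.str i).Dom (σ a)}
    {v : (a : α) → F.prod.Dom (σ a)} (h : Represents u v) {s : L.Sorts} (t : LTerm L α σ s) :
    ∀ᶠ i in F.ultra, rep (t.realize F.prod v) i = t.realize (F.str i) (u i) := by
  cases t with
  | var a => exact h a
  | const c => exact rep_constMap c

theorem Represents.relMap_iff {u : (i : F.Idx) → (a : α) → (F.str i).Dom (σ a)}
    {v : (a : α) → F.prod.Dom (σ a)} (h : Represents u v) {n : ℕ} {ρ : Fin n → L.Sorts}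
    (R : L.Rel n ρ) (ts : (i : Fin n) → LTerm L α σ (ρ i)) :
    F.prod.relMap R (fun k => (ts k).realize F.prod v) ↔
      ∀ᶠ i in F.ultra, (F.str i).relMap R (fun k => (ts k).realize (F.str i) (u i)) := by
  refine Filter.eventually_congr ?_
  filter_upwards [Filter.eventually_all.2 fun k => h.realize_term (ts k)] with i hi
  exact iff_of_eq (congrArg _ (funext hi))

theorem Represents.vcons {u : (i : F.Idx) → (a : α) → (F.str i).Dom (σ a)}
    {v : (a : α) → F.prod.Dom (σ a)} (h : Represents u v) {s : L.Sorts}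
    {f : (i : F.Idx) → (F.str i).Dom s} {x : F.prod.Dom s}
    (hx : ∀ᶠ i in F.ultra, rep x i = f i) :
    Represents (σ := osort s σ) (fun i => _root_.vcons (f i) (u i)) (_root_.vcons x v)
  | none => hx
  | some a => h a

theorem Represents.eventually_realize (φ : PosForm L α σ)
    {u : (i : F.Idx) → (a : α) → (F.str i).Dom (σ a)} {v : (a : α) → F.prod.Dom (σ a)}
    (h : Represents u v) (hφ : φ.Realize F.prod v) :
    ∀ᶠ i in F.ultra, φ.Realize (F.str i) (u i) := by
  induction φ with
  | rel R ts => exact (h.relMap_iff R ts).1 hφ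
  | and φ ψ ih₁ ih₂ => exact (ih₁ h hφ.1).and (ih₂ h hφ.2)
  | or φ ψ ih₁ ih₂ =>
    rcases hφ with hφ | hφ
    · exact (ih₁ h hφ).mono fun _ => Or.inl
    · exact (ih₂ h hφ).mono fun _ => Or.inr
  | ex s φ ih =>
    obtain ⟨x, hx⟩ := hφ
    exact (ih (h.vcons (f := rep x) (Filter.Eventually.of_forall fun _ => rfl)) hx).mono
      fun i hi => ⟨rep x i, hi⟩

theorem Represents.realize_prod (φ : LPosForm L α σ)
    {u : (i : F.Idx) → (a : α) → (F.str i).Dom (σ a)} {v : (a : α) → F.prod.Dom (σ a)}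
    (h : Represents u v) (hφ : ∀ᶠ i in F.ultra, φ.Realize (F.str i) (u i)) :
    φ.Realize F.prod v := by
  induction φ with
  | rel R ts => exact (h.relMap_iff R ts).2 hφ
  | and φ ψ ih₁ ih₂ => exact ⟨ih₁ h (hφ.mono fun _ => And.left), ih₂ h (hφ.mono fun _ => And.right)⟩
  | or φ ψ ih₁ ih₂ => exact (Ultrafilter.eventually_or.1 hφ).imp (ih₁ h) (ih₂ h)
  | @lex α σ s d t φ ih =>
    have ht := h.realize_term t
    let f : (i : F.Idx) → (F.str i).Dom s := fun i =>
      open Classical in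
      if h : (LPosForm.lex s d t φ).Realize (F.str i) (u i) then h.choose
      else rep (t.realize F.prod v) i
    have hf : ∀ᶠ i in F.ultra, (F.str i).locRel d (f i) (t.realize (F.str i) (u i)) ∧
        φ.Realize (F.str i) (_root_.vcons (f i) (u i)) := by
      filter_upwards [hφ] with i hi
      simp only [f, dif_pos hi]
      exact hi.choose_spec
    have hfr : ∀ᶠ i in F.ultra, (F.str i).locRel d (f i) (rep (t.realize F.prod v) i) := by
      filter_upwards [hf, ht] with i hi ht
      rw [ht]
      exact hi.1
    have hb : F.Bounded f := Bounded.of_locRel (bounded_rep (t.realize F.prod v)) hfr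
    refine ⟨point f hb, ?_, ih (h.vcons (rep_point f hb)) (hf.mono fun _ => And.right)⟩
    rw [locRel_prod]
    filter_upwards [hfr, rep_point f hb] with i hi hr
    rwa [hr]

/-- A family of maps into the factors that is eventually compatible with every atomic fact
gives a homomorphism to the bounded ultraproduct. -/
def homProd (N : LStructure L) (H : (i : F.Idx) → (s : L.Sorts) → N.Dom s → (F.str i).Dom s)
    (hb : ∀ s (x : N.Dom s), F.Bounded fun i => H i s x)
    (hrel : ∀ {n : ℕ} {ρ : Fin n → L.Sorts} (R : L.Rel n ρ) (x : (k : Fin n) → N.Dom (ρ k)),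
      N.relMap R x → ∀ᶠ i in F.ultra, (F.str i).relMap R fun k => H i (ρ k) (x k))
    (hconst : ∀ {s : L.Sorts} (c : L.Const s),
      ∀ᶠ i in F.ultra, H i s (N.constMap c) = (F.str i).constMap c) : LHom N F.prod where
  toFun s x := point (fun i => H i s x) (hb s x)
  map_rel {n ρ} R x hx := by
    change ∀ᶠ i in F.ultra, (F.str i).relMap R fun k => rep (point (fun i => H i (ρ k) (x k)) _) i
    filter_upwards [hrel R x hx, Filter.eventually_all.2 fun k =>
      rep_point (fun i => H i (ρ k) (x k)) (hb _ _)] with i h₁ h₂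
    simpa only [h₂] using h₁
  map_const {s} c := by
    refine ext_of_eventually ?_
    filter_upwards [hconst c, rep_point (fun i => H i s (N.constMap c)) (hb _ _),
      rep_constMap c] with i h₁ h₂ h₃
    rw [h₂, h₁]
    exact h₃.symm

theorem homProd_apply_eq {N N' : LStructure L}
    {H : (i : F.Idx) → (s : L.Sorts) → N.Dom s → (F.str i).Dom s}
    {H' : (i : F.Idx) → (s : L.Sorts) → N'.Dom s → (F.str i).Dom s}
    {hb hrel hconst hb' hrel' hconst'} {s : L.Sorts} {x : N.Dom s} {y : N'.Dom s}
    (h : ∀ᶠ i in F.ultra, H i s x = H' i s y) :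
    (homProd N H hb hrel hconst).toFun s x = (homProd N' H' hb' hrel' hconst').toFun s y := by
  refine ext_of_eventually ?_
  filter_upwards [h, rep_point (fun i => H i s x) (hb _ _),
    rep_point (fun i => H' i s y) (hb' _ _)] with i h₁ h₂ h₃
  exact h₂.trans (h₁.trans h₃.symm)

end BasedFamily

end BoundedProduct

/-! ## Finite partial homomorphisms and amalgamation -/

section Amalgamation

variable {L : LocalLanguage}

/-- A relation symbol together with a tuple of elements it may be applied to. -/
structure AtomicInstance (N : LStructure L) where
  arity : ℕ
  sorts : Fin arity → L.Sorts
  symbol : L.Rel arity sorts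
  args : (i : Fin arity) → N.Dom (sorts i)

/-- The atomic instance holds in `N`. -/
def AtomicInstance.Holds {N : LStructure L} (p : AtomicInstance N) : Prop :=
  N.relMap p.symbol p.args

/-- The image of the atomic instance under a sorted map holds in `D`. -/
def AtomicInstance.HoldsImage {N D : LStructure L} (p : AtomicInstance N)
    (H : ∀ s, N.Dom s → D.Dom s) : Prop :=
  D.relMap p.symbol fun i => H (p.sorts i) (p.args i)

theorem exists_sorted_extension {N D : LStructure L} {α : Type} {σ : α → L.Sorts}
    (v : (a : α) → N.Dom (σ a)) (hv : Function.Injective fun a => (⟨σ a, v a⟩ : Σ s, N.Dom s))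
    (w : (a : α) → D.Dom (σ a)) (hne : ∀ s, N.Dom s → Nonempty (D.Dom s)) :
    ∃ H : ∀ s, N.Dom s → D.Dom s, ∀ a, H _ (v a) = w a := by
  have key : ∀ p : Σ s, N.Dom s, ∃ y : D.Dom p.1,
      ∀ a, (⟨σ a, v a⟩ : Σ s, N.Dom s) = p → HEq (w a) y := by
    intro p
    by_cases hp : ∃ a, (⟨σ a, v a⟩ : Σ s, N.Dom s) = p
    · obtain ⟨a, rfl⟩ := hp
      refine ⟨w a, fun a' h => ?_⟩
      obtain rfl := hv h
      rfl
    · exact ⟨(hne p.1 p.2).some, fun a h => (hp ⟨a, h⟩).elim⟩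
  choose H hH using key
  exact ⟨fun s x => H ⟨s, x⟩, fun a => (eq_of_heq (hH ⟨σ a, v a⟩ a rfl)).symm⟩

theorem exists_term_of_mem_range {N : LStructure L} {α : Type} {σ : α → L.Sorts}
    (v : (a : α) → N.Dom (σ a)) {s : L.Sorts} (x : N.Dom s)
    (hx : ∃ a, (⟨σ a, v a⟩ : Σ s, N.Dom s) = ⟨s, x⟩) :
    ∃ t : LTerm L α σ s, t.realize N v = x ∧
      ∀ (D : LStructure L) (w : (a : α) → D.Dom (σ a)) (H : ∀ s, N.Dom s → D.Dom s),
        (∀ a, H _ (v a) = w a) → t.realize D w = H s x := by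
  obtain ⟨a, ha⟩ := hx
  cases ha
  exact ⟨.var a, rfl, fun D w H hH => (hH a).symm⟩

theorem exists_conjunction_of_atomicInstances {N : LStructure L} {α : Type} {σ : α → L.Sorts}
    (v : (a : α) → N.Dom (σ a)) (F : List (AtomicInstance N)) (hne : F ≠ [])
    (hF : ∀ p ∈ F, p.Holds)
    (hmem : ∀ p ∈ F, ∀ i, ∃ a, (⟨σ a, v a⟩ : Σ s, N.Dom s) = ⟨p.sorts i, p.args i⟩) :
    ∃ φ : PosForm L α σ, φ.Realize N v ∧
      ∀ (D : LStructure L) (w : (a : α) → D.Dom (σ a)) (H : ∀ s, N.Dom s → D.Dom s),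
        (∀ a, H _ (v a) = w a) → φ.Realize D w → ∀ p ∈ F, p.HoldsImage H := by
  induction F with
  | nil => exact (hne rfl).elim
  | cons p F ih =>
    choose t htN htD using fun i => exists_term_of_mem_range v (p.args i)
      (hmem p List.mem_cons_self i)
    have hp : (PosForm.rel p.symbol t).Realize N v := by
      change N.relMap p.symbol fun i => (t i).realize N v
      rw [funext htN]
      exact hF p List.mem_cons_self
    have hpD : ∀ (D : LStructure L) (w : (a : α) → D.Dom (σ a)) (H : ∀ s, N.Dom s → D.Dom s),
        (∀ a, H _ (v a) = w a) → (PosForm.rel p.symbol t).Realize D w → p.HoldsImage H := by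
      intro D w H hH h
      change D.relMap p.symbol fun i => (t i).realize D w at h
      rwa [funext fun i => htD i D w H hH] at h
    by_cases hnil : F = []
    · subst hnil
      refine ⟨_, hp, fun D w H hH h q hq => ?_⟩
      rw [List.mem_singleton] at hq
      exact hq ▸ hpD D w H hH h
    · obtain ⟨φ, hφN, hφD⟩ := ih hnil (fun q hq => hF q (List.mem_cons_of_mem _ hq))
        fun q hq => hmem q (List.mem_cons_of_mem _ hq)
      refine ⟨.and (.rel p.symbol t) φ, ⟨hp, hφN⟩, fun D w H hH h q hq => ?_⟩
      rcases List.mem_cons.1 hq with rfl | hq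
      · exact hpD D w H hH h.1
      · exact hφD D w H hH h.2 q hq

theorem exists_formula_of_atomicInstances {N : LStructure L} (F : List (AtomicInstance N))
    (hne : F ≠ []) (hF : ∀ p ∈ F, p.Holds) (l : List (Σ s, N.Dom s)) :
    ∀ {α : Type} {σ : α → L.Sorts} (v : (a : α) → N.Dom (σ a)),
      Function.Injective (fun a => (⟨σ a, v a⟩ : Σ s, N.Dom s)) →
      (∀ p ∈ F, ∀ i, (⟨p.sorts i, p.args i⟩ : Σ s, N.Dom s) ∈ l ∨
        ∃ a, (⟨σ a, v a⟩ : Σ s, N.Dom s) = ⟨p.sorts i, p.args i⟩) →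
      ∃ φ : PosForm L α σ, φ.Realize N v ∧
        ∀ (D : LStructure L) (w : (a : α) → D.Dom (σ a)),
          (∀ s, N.Dom s → Nonempty (D.Dom s)) → φ.Realize D w →
          ∃ H : ∀ s, N.Dom s → D.Dom s, (∀ a, H _ (v a) = w a) ∧ ∀ p ∈ F, p.HoldsImage H := by
  induction l with
  | nil =>
    intro α σ v hv hmem
    obtain ⟨φ, hφN, hφD⟩ := exists_conjunction_of_atomicInstances v F hne hF
      fun p hp i => (hmem p hp i).resolve_left List.not_mem_nil
    refine ⟨φ, hφN, fun D w hD h => ?_⟩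
    obtain ⟨H, hH⟩ := exists_sorted_extension v hv w hD
    exact ⟨H, hH, hφD D w H hH h⟩
  | cons y l ih =>
    intro α σ v hv hmem
    by_cases hy : ∃ a, (⟨σ a, v a⟩ : Σ s, N.Dom s) = y
    · refine ih v hv fun p hp i => ?_
      rcases hmem p hp i with h | h
      · rcases List.mem_cons.1 h with h | h
        · exact Or.inr (h ▸ hy)
        · exact Or.inl h
      · exact Or.inr h
    · obtain ⟨s, x⟩ := y
      obtain ⟨φ, hφN, hφD⟩ := ih (σ := osort s σ) (vcons x v) (by
        rintro (_ | a) (_ | b) h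
        · rfl
        · exact (hy ⟨b, h.symm⟩).elim
        · exact (hy ⟨a, h⟩).elim
        · exact congrArg some (hv h)) (by
        intro p hp i
        rcases hmem p hp i with h | ⟨a, ha⟩
        · rcases List.mem_cons.1 h with h | h
          · exact Or.inr ⟨none, h.symm⟩
          · exact Or.inl h
        · exact Or.inr ⟨some a, ha⟩)
      refine ⟨.ex s φ, ⟨x, hφN⟩, fun D w hD h => ?_⟩
      obtain ⟨z, hz⟩ := h
      obtain ⟨H, hH, hHF⟩ := hφD D (vcons z w) hD hz
      exact ⟨H, fun a => hH (some a), hHF⟩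

/-- If every positive formula true of `v` in `N` is true of `w` in `D`, then any finitely many
atomic facts of `N` are preserved by some map sending `v` to `w`. -/
theorem exists_map_preserving {N D : LStructure L} {α : Type} {σ : α → L.Sorts}
    (v : (a : α) → N.Dom (σ a)) (hv : Function.Injective fun a => (⟨σ a, v a⟩ : Σ s, N.Dom s))
    (w : (a : α) → D.Dom (σ a)) (hne : ∀ s, N.Dom s → Nonempty (D.Dom s))
    (hvw : ∀ φ : PosForm L α σ, φ.Realize N v → φ.Realize D w)
    (F : Finset (AtomicInstance N)) :
    ∃ H : ∀ s, N.Dom s → D.Dom s, (∀ a, H _ (v a) = w a) ∧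
      ∀ p ∈ F, p.Holds → p.HoldsImage H := by
  classical
  by_cases hnil : (F.filter fun p => p.Holds).toList = []
  · obtain ⟨H, hH⟩ := exists_sorted_extension v hv w hne
    refine ⟨H, hH, fun p hp h => ?_⟩
    have : p ∈ (F.filter fun p => p.Holds).toList := by simp [hp, h]
    simp [hnil] at this
  · obtain ⟨φ, hφN, hφD⟩ := exists_formula_of_atomicInstances
      (F.filter fun p => p.Holds).toList hnil (by simp)
      ((F.filter fun p => p.Holds).toList.flatMap fun p =>
        List.ofFn fun i => (⟨p.sorts i, p.args i⟩ : Σ s, N.Dom s)) v hv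
      (fun p hp i => Or.inl (List.mem_flatMap.2 ⟨p, hp, List.mem_ofFn.2 ⟨i, rfl⟩⟩))
    obtain ⟨H, hH, hHF⟩ := hφD D w hne (hvw φ hφN)
    exact ⟨H, hH, fun p hp h => hHF p (by simp [hp, h])⟩

/-- Amalgamation: if every finite set of atomic facts of `N` is preserved by a map into `D`
sending `v` to `w`, then `N` and `D` map compatibly into a local model of the theory of `D`. -/
theorem exists_amalgam {N D : LStructure L} (hN : IsLocal N) (hD : IsLocal D)
    {α : Type} {σ : α → L.Sorts} (v : (a : α) → N.Dom (σ a)) (w : (a : α) → D.Dom (σ a))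
    (hsorts : ∀ s, N.Dom s → ∃ a, σ a = s)
    (hmap : ∀ F : Finset (AtomicInstance N), ∃ H : ∀ s, N.Dom s → D.Dom s,
      (∀ a, H _ (v a) = w a) ∧ (∀ {s} (c : L.Const s), H s (N.constMap c) = D.constMap c) ∧
        ∀ p ∈ F, p.Holds → p.HoldsImage H) :
    ∃ P : LStructure L, LocalModel P (ThNeg D) ∧ ∃ (i : LHom D P) (j : LHom N P),
      ∀ a, j.toFun _ (v a) = i.toFun _ (w a) := by
  classical
  choose H hHv hHc hHF using hmap
  let F : BasedFamily L :=
    { Idx := Finset (AtomicInstance N)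
      ultra := Ultrafilter.of Filter.atTop
      str := fun _ => D
      isLocal := fun _ => hD
      base := fun s => Set.range fun x _ => x
      const_mem := fun c => ⟨D.constMap c, rfl⟩
      base_bounded := by
        rintro s _ ⟨x, rfl⟩ _ ⟨y, rfl⟩
        obtain ⟨d, hd⟩ := hD.total x y
        exact ⟨d, Filter.Eventually.of_forall fun _ => hd⟩ }
  have hev : ∀ p : AtomicInstance N, p.Holds → ∀ᶠ i in F.ultra, p.HoldsImage (H i) := by
    intro p hp
    have : ∀ᶠ i : Finset (AtomicInstance N) in Filter.atTop, p.HoldsImage (H i) :=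
      (Filter.eventually_ge_atTop {p}).mono fun i hi =>
        hHF i p (hi (Finset.mem_singleton_self p)) hp
    exact Ultrafilter.of_le _ this
  have hloc : ∀ {s} (d : L.Loc s) (x y : N.Dom s), N.locRel d x y →
      ∀ᶠ i in F.ultra, D.locRel d (H i s x) (H i s y) := by
    intro s d x y hxy
    filter_upwards [hev ⟨2, ![s, s], L.locToRel d, dpair x y⟩ hxy] with i hi
    exact (congrArg (D.relMap (L.locToRel d)) (dpair_map (C := fun k => N.Dom (![s, s] k))
      (D := fun k => D.Dom (![s, s] k)) (fun k z => H i (![s, s] k) z) x y)).mp hi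
  let i : LHom D F.prod := BasedFamily.homProd D (fun _ _ x => x)
    (fun s x => BasedFamily.bounded_of_mem_base ⟨x, rfl⟩)
    (fun R x hx => Filter.Eventually.of_forall fun _ => hx)
    (fun c => Filter.Eventually.of_forall fun _ => rfl)
  let j : LHom N F.prod := BasedFamily.homProd N H
    (by
      intro s x
      obtain ⟨a, rfl⟩ := hsorts s x
      obtain ⟨d, hd⟩ := hN.total x (v a)
      refine ⟨fun _ => w a, ⟨w a, rfl⟩, d, ?_⟩
      exact (hloc d x (v a) hd).mono fun i hi => (congrArg (D.locRel d _) (hHv i a)).mp hi)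
    (fun {n ρ} R x hx => hev ⟨n, ρ, R, x⟩ hx)
    (fun c => Filter.Eventually.of_forall fun i => hHc i c)
  refine ⟨F.prod, ⟨F.isLocal_prod, fun φ hφ h => hφ ?_⟩, i, j, fun a =>
    BasedFamily.homProd_apply_eq (Filter.Eventually.of_forall fun i => hHv i a)⟩
  obtain ⟨_, hi⟩ :=
    (BasedFamily.Represents.eventually_realize φ (BasedFamily.represents_rep _) h).exists
  rwa [Subsingleton.elim (fun a => _) (fun e : Empty => e.elim)] at hi

end Amalgamation

/-! ## Joint models over constants -/

section JointModels

variable {L : LocalLanguage}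

theorem LHom.realize_posForm {M N : LStructure L} (h : LHom M N) {α : Type} {σ : α → L.Sorts}
    (φ : PosForm L α σ) (v : (a : α) → M.Dom (σ a)) (hφ : φ.Realize M v) :
    φ.Realize N (fun a => h.toFun (σ a) (v a)) := by
  induction φ with
  | rel R ts =>
    simp only [PosForm.Realize, h.realize_term] at hφ ⊢
    exact h.map_rel R _ hφ
  | and φ ψ ih₁ ih₂ => exact ⟨ih₁ v hφ.1, ih₂ v hφ.2⟩
  | or φ ψ ih₁ ih₂ => exact hφ.imp (ih₁ v) (ih₂ v)
  | ex s φ ih =>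
    obtain ⟨x, hφ⟩ := hφ
    refine ⟨h.toFun s x, ?_⟩
    rw [vcons_map h.toFun]
    exact ih _ hφ

theorem LHom.realizedIn {M N : LStructure L} (h : LHom M N) {φ : PosSentence L}
    (hφ : φ.RealizedIn M) : φ.RealizedIn N := by
  have := h.realize_posForm φ _ hφ
  rwa [Subsingleton.elim (fun e : Empty => h.toFun _ _) (fun e : Empty => e.elim)] at this

theorem LocalModel.realizedIn_of_thNeg {M N : LStructure L} (hN : LocalModel N (ThNeg M))
    {φ : PosSentence L} (hφ : φ.RealizedIn N) : φ.RealizedIn M :=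
  by_contra fun h => hN.2 φ h hφ

/-- The positive formula expressing equality of two terms. -/
def eqForm {α : Type} {σ : α → L.Sorts} {s : L.Sorts} (t u : LTerm L α σ s) : PosForm L α σ :=
  .rel (L.locToRel (L.dd0 s)) (tpair t u)

theorem realize_eqForm {M : LStructure L} (hM : IsLocal M) {α : Type} {σ : α → L.Sorts}
    {s : L.Sorts} (t u : LTerm L α σ s) (v : (a : α) → M.Dom (σ a)) :
    (eqForm t u).Realize M v ↔ t.realize M v = u.realize M v :=
  (iff_of_eq (congrArg (M.relMap (L.locToRel (L.dd0 s))) (realize_tpair M v t u))).trans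
    (hM.dd0_eq _ _)

/-- The positive formula expressing that a sort is nonempty. -/
def nonemptyForm {α : Type} {σ : α → L.Sorts} (s : L.Sorts) : PosForm L α σ :=
  .ex s (eqForm (LTerm.bound s) (LTerm.bound s))

theorem realize_nonemptyForm {M : LStructure L} (hM : IsLocal M) {α : Type} {σ : α → L.Sorts}
    {s : L.Sorts} (v : (a : α) → M.Dom (σ a)) :
    (nonemptyForm s).Realize M v ↔ Nonempty (M.Dom s) :=
  ⟨fun ⟨x, _⟩ => ⟨x⟩, fun ⟨x⟩ => ⟨x, (realize_eqForm hM _ _ _).2 rfl⟩⟩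

theorem exists_joint_model {N D : LStructure L} (hN : IsLocal N) (hD : IsLocal D)
    (h : ∀ φ : PosSentence L, φ.RealizedIn N → φ.RealizedIn D)
    (hc : ∀ s, N.Dom s → Nonempty (L.Const s)) :
    ∃ P : LStructure L, LocalModel P (ThNeg D) ∧ Nonempty (LHom D P) ∧ Nonempty (LHom N P) := by
  let α : Type := {p : Σ s, N.Dom s // ∃ c : L.Const p.1, N.constMap c = p.2}
  let σ : α → L.Sorts := fun a => a.1.1
  let v : (a : α) → N.Dom (σ a) := fun a => a.1.2
  let c : (a : α) → L.Const (σ a) := fun a => a.2.choose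
  have hcv : ∀ a, N.constMap (c a) = v a := fun a => a.2.choose_spec
  have hconst : ∀ {s} (c₁ c₂ : L.Const s), N.constMap c₁ = N.constMap c₂ →
      D.constMap c₁ = D.constMap c₂ := by
    intro s c₁ c₂ h₁₂
    exact (realize_eqForm hD (LTerm.const c₁) (LTerm.const c₂) _).1
      (h (eqForm (LTerm.const c₁) (LTerm.const c₂)) ((realize_eqForm hN _ _ _).2 h₁₂))
  have hmap := exists_map_preserving (D := D) v (fun a b hab => Subtype.ext hab)
    (fun a => D.constMap (c a))
    (fun s x => (realize_nonemptyForm hD _).1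
      (h (nonemptyForm s) ((realize_nonemptyForm hN _).2 ⟨x⟩)))
    (by
      intro φ hφ
      refine (φ.realize_subst D (fun a => LTerm.const (c a)) (fun e : Empty => e.elim)).1
        (h (φ.subst fun a => LTerm.const (c a)) ?_)
      refine (φ.realize_subst N (fun a => LTerm.const (c a)) (fun e : Empty => e.elim)).2 ?_
      rwa [← funext hcv] at hφ)
  obtain ⟨P, hP, i, j, -⟩ := exists_amalgam hN hD v (fun a => D.constMap (c a))
    (fun s x => by
      obtain ⟨k⟩ := hc s x
      exact ⟨⟨⟨s, N.constMap k⟩, k, rfl⟩, rfl⟩)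
    (fun F => by
      obtain ⟨H, hHv, hHF⟩ := hmap F
      refine ⟨H, hHv, fun {s} k => ?_, hHF⟩
      let a : α := ⟨⟨s, N.constMap k⟩, k, rfl⟩
      exact (hHv a).trans (hconst _ _ (hcv a)))
  exact ⟨P, hP, ⟨i⟩, ⟨j⟩⟩

theorem hasLJP_thNeg {M : LStructure L} (hM : IsLocal M)
    (hc : ∀ s, M.Dom s → Nonempty (L.Const s)) : HasLJP (ThNeg M) := by
  have hconst : ∀ {N : LStructure L}, LocalModel N (ThNeg M) → ∀ s, N.Dom s →
      Nonempty (L.Const s) := fun hN s x =>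
    hc s ((realize_nonemptyForm hM _).1
      (hN.realizedIn_of_thNeg (φ := nonemptyForm s) ((realize_nonemptyForm hN.1 _).2 ⟨x⟩))).some
  intro A B hA hB
  obtain ⟨P, hP, ⟨f⟩, ⟨g⟩⟩ :=
    exists_joint_model hA.1 hM (fun φ => hA.realizedIn_of_thNeg) (hconst hA)
  obtain ⟨Q, hQ, ⟨i⟩, ⟨j⟩⟩ := exists_joint_model hB.1 hP.1
    (fun φ hφ => f.realizedIn (hB.realizedIn_of_thNeg hφ)) (hconst hB)
  exact ⟨Q, ⟨hQ.1, fun φ hφ h => hP.2 φ hφ (hQ.realizedIn_of_thNeg h)⟩, ⟨i.comp g⟩, ⟨j⟩⟩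

end JointModels

/-! ## Compactness and maximal types -/

section Types

variable {L : LocalLanguage}

/-- The variables of a context extended by variables of the listed sorts. -/
def ctxType (α : Type) : List L.Sorts → Type
  | [] => α
  | _ :: l => Option (ctxType α l)

/-- The sort assignment of a context extended by variables of the listed sorts. -/
def ctxSort {α : Type} (σ : α → L.Sorts) : (l : List L.Sorts) → ctxType α l → L.Sorts
  | [] => σ
  | s :: l => osort s (ctxSort σ l)

/-- Local positive formulas over a fixed base context, in the lowest universe. -/
inductive SmallForm (L : LocalLanguage) (α : Type) (σ : α → L.Sorts) : List L.Sorts → Type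
  | rel {l : List L.Sorts} {n : ℕ} {ρ : Fin n → L.Sorts} (R : L.Rel n ρ)
      (ts : (i : Fin n) → LTerm L (ctxType α l) (ctxSort σ l) (ρ i)) : SmallForm L α σ l
  | and {l : List L.Sorts} (φ ψ : SmallForm L α σ l) : SmallForm L α σ l
  | or {l : List L.Sorts} (φ ψ : SmallForm L α σ l) : SmallForm L α σ l
  | lex {l : List L.Sorts} (s : L.Sorts) (d : L.Loc s)
      (t : LTerm L (ctxType α l) (ctxSort σ l) s) (φ : SmallForm L α σ (s :: l)) :
      SmallForm L α σ l

/-- The local positive formula presented by a small formula. -/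
def SmallForm.toLPosForm {α : Type} {σ : α → L.Sorts} :
    {l : List L.Sorts} → SmallForm L α σ l → LPosForm L (ctxType α l) (ctxSort σ l)
  | _, .rel R ts => .rel R ts
  | _, .and φ ψ => .and φ.toLPosForm ψ.toLPosForm
  | _, .or φ ψ => .or φ.toLPosForm ψ.toLPosForm
  | _, .lex s d t φ => .lex s d t φ.toLPosForm

theorem SmallForm.exists_toLPosForm_heq {α : Type} {σ : α → L.Sorts} {β : Type} {τ : β → L.Sorts}
    (φ : LPosForm L β τ) : ∀ l : List L.Sorts, ctxType α l = β → HEq (ctxSort σ l) τ →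
      ∃ r : SmallForm L α σ l, HEq r.toLPosForm φ := by
  induction φ with
  | rel R ts =>
    rintro l rfl h
    obtain rfl := eq_of_heq h
    exact ⟨.rel R ts, HEq.rfl⟩
  | and φ ψ ih₁ ih₂ =>
    rintro l rfl h
    obtain rfl := eq_of_heq h
    obtain ⟨r₁, h₁⟩ := ih₁ l rfl HEq.rfl
    obtain ⟨r₂, h₂⟩ := ih₂ l rfl HEq.rfl
    exact ⟨.and r₁ r₂, heq_of_eq (congrArg₂ _ (eq_of_heq h₁) (eq_of_heq h₂))⟩
  | or φ ψ ih₁ ih₂ =>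
    rintro l rfl h
    obtain rfl := eq_of_heq h
    obtain ⟨r₁, h₁⟩ := ih₁ l rfl HEq.rfl
    obtain ⟨r₂, h₂⟩ := ih₂ l rfl HEq.rfl
    exact ⟨.or r₁ r₂, heq_of_eq (congrArg₂ _ (eq_of_heq h₁) (eq_of_heq h₂))⟩
  | lex s d t φ ih =>
    rintro l rfl h
    obtain rfl := eq_of_heq h
    obtain ⟨r, hr⟩ := ih (s :: l) rfl HEq.rfl
    exact ⟨.lex s d t r, heq_of_eq (congrArg _ (eq_of_heq hr))⟩

instance LPosForm.small {α : Type} {σ : α → L.Sorts} : Small.{0} (LPosForm L α σ) :=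
  small_of_surjective (f := fun r : SmallForm L α σ [] => r.toLPosForm) fun φ =>
    (SmallForm.exists_toLPosForm_heq φ [] rfl HEq.rfl).imp fun _ => eq_of_heq

/-- A set of local positive formulas bounds its variables if it places each of them at some
fixed distance from a constant. -/
def BoundsVariables {α : Type} {σ : α → L.Sorts} (Δ : Set (LPosForm L α σ)) : Prop :=
  ∀ a, ∃ (d : L.Loc (σ a)) (c : L.Const (σ a)),
    LPosForm.rel (L.locToRel d) (tpair (LTerm.var a) (LTerm.const c)) ∈ Δ

theorem realize_locToRel_tpair {M : LStructure L} {α : Type} {σ : α → L.Sorts} {s : L.Sorts}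
    {d : L.Loc s} (t u : LTerm L α σ s) (v : (a : α) → M.Dom (σ a)) :
    (LPosForm.rel (L.locToRel d) (tpair t u)).Realize M v ↔
      M.locRel d (t.realize M v) (u.realize M v) :=
  iff_of_eq (congrArg (M.relMap (L.locToRel d)) (realize_tpair M v t u))

theorem FinLocSat.isPartialLType {T : Set (PosSentence L)} {α : Type} {σ : α → L.Sorts}
    {Δ : Set (LPosForm L α σ)} (h : FinLocSat T Δ) (hb : BoundsVariables Δ) :
    IsPartialLType T Δ := by
  classical
  let X : Type := Shrink.{0} Δ
  let form : X → LPosForm L α σ := fun x => ((equivShrink Δ).symm x).1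
  have hsat : ∀ Φ : Finset X, ∃ (M : LStructure L) (v : (a : α) → M.Dom (σ a)),
      LocalModel M T ∧ ∀ x ∈ Φ, (form x).Realize M v := by
    intro Φ
    obtain ⟨M, v, hM, hv⟩ := h (form '' (Φ : Set X)) (by
      rintro _ ⟨x, -, rfl⟩
      exact ((equivShrink Δ).symm x).2) (Φ.finite_toSet.image _)
    exact ⟨M, v, hM, fun x hx => hv _ ⟨x, hx, rfl⟩⟩
  choose M v hM hv using hsat
  let F : BasedFamily L :=
    { Idx := Finset X
      ultra := Ultrafilter.of Filter.atTop
      str := M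
      isLocal := fun i => (hM i).1
      base := fun s => Set.range fun (c : L.Const s) i => (M i).constMap c
      const_mem := fun c => ⟨c, rfl⟩
      base_bounded := by
        rintro s _ ⟨c₁, rfl⟩ _ ⟨c₂, rfl⟩
        exact ⟨L.bound c₁ c₂, Filter.Eventually.of_forall fun i => (hM i).1.boundAx c₁ c₂⟩ }
  have hev : ∀ φ ∈ Δ, ∀ᶠ i in F.ultra, φ.Realize (F.str i) (v i) := by
    intro φ hφ
    have : ∀ᶠ i : Finset X in Filter.atTop, φ.Realize (M i) (v i) := by
      refine (Filter.eventually_ge_atTop {equivShrink Δ ⟨φ, hφ⟩}).mono fun i hi => ?_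
      have := hv i _ (hi (Finset.mem_singleton_self _))
      simpa only [form, Equiv.symm_apply_apply] using this
    exact Ultrafilter.of_le _ this
  have hbd : ∀ a, F.Bounded fun i => v i a := by
    intro a
    obtain ⟨d, c, hdc⟩ := hb a
    exact ⟨_, ⟨c, rfl⟩, d, (hev _ hdc).mono fun i hi => (realize_locToRel_tpair _ _ _).1 hi⟩
  have hrep : BasedFamily.Represents (F := F) v
      fun a => BasedFamily.point (F := F) (fun i => v i a) (hbd a) :=
    fun a => BasedFamily.rep_point _ (hbd a)
  refine ⟨F.prod, _, ⟨F.isLocal_prod, fun φ hφ h => ?_⟩, fun φ hφ => hrep.realize_prod φ (hev φ hφ)⟩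
  obtain ⟨i, hi⟩ := (BasedFamily.Represents.eventually_realize φ (u := fun i e => e.elim)
    (fun e => e.elim) h).exists
  exact (hM i).2 φ hφ hi

theorem IsPartialLType.exists_isLType {T : Set (PosSentence L)} {α : Type} {σ : α → L.Sorts}
    {Γ : Set (LPosForm L α σ)} (h : IsPartialLType T Γ) (hb : BoundsVariables Γ) :
    ∃ Γ', Γ ⊆ Γ' ∧ IsLType T Γ' := by
  obtain ⟨Γ', hΓ, hmax⟩ := zorn_subset_nonempty {Δ | Γ ⊆ Δ ∧ IsPartialLType T Δ}
    (fun c hc hchain hne => by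
      have hsub : Γ ⊆ ⋃₀ c := (hc hne.some_mem).1.trans (Set.subset_sUnion_of_mem hne.some_mem)
      refine ⟨⋃₀ c, ⟨hsub, FinLocSat.isPartialLType (fun Δ₀ hΔ₀ hfin => ?_) fun a => ?_⟩,
        fun Δ hΔ => Set.subset_sUnion_of_mem hΔ⟩
      · obtain ⟨Δ, hΔ, hsub'⟩ := hchain.directedOn.exists_mem_subset_of_finite_of_subset_sUnion
          hne hfin hΔ₀
        obtain ⟨M, v, hM, hv⟩ := (hc hΔ).2
        exact ⟨M, v, hM, fun φ hφ => hv φ (hsub' hφ)⟩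
      · obtain ⟨d, k, hdk⟩ := hb a
        exact ⟨d, k, hsub hdk⟩) Γ ⟨Set.Subset.rfl, h⟩
  exact ⟨Γ', hΓ, hmax.prop.2, fun Δ hΔ hsub =>
    (hmax.le_of_ge ⟨hΓ.trans hsub, hΔ⟩ hsub).antisymm hsub⟩

end Types

/-! ## Expansions by parameters -/

section Parameters

variable {L : LocalLanguage} {M : LStructure L} {hM : IsLocal M} {A : ParamSet M}

theorem isLocal_withParams : IsLocal (M.withParams hM A) where
  symm := hM.symm
  mono := hM.mono
  comp := hM.comp
  boundAx c₁ c₂ := by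
    rcases c₁ with c₁ | c₁ <;> rcases c₂ with c₂ | c₂
    · exact hM.boundAx c₁ c₂
    all_goals exact Classical.choose_spec (hM.total _ _)
  total := hM.total
  dd0_eq := hM.dd0_eq

/-- The restriction of a structure in the expanded language to the original one. -/
def paramReduct (N : LStructure (L.withParams M hM A)) : LStructure L where
  Dom := N.Dom
  relMap := N.relMap
  constMap c := N.constMap (Sum.inl c)

theorem IsLocal.paramReduct {N : LStructure (L.withParams M hM A)} (hN : IsLocal N) :
    IsLocal (paramReduct N) where
  symm := hN.symm
  mono := hN.mono
  comp := hN.comp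
  boundAx c₁ c₂ := hN.boundAx (Sum.inl c₁) (Sum.inl c₂)
  total := hN.total
  dd0_eq := hN.dd0_eq

/-- A homomorphism in the expanded language, viewed in the original one. -/
def LHom.paramReduct {N P : LStructure (L.withParams M hM A)} (h : LHom N P) :
    LHom (paramReduct N) (paramReduct P) where
  toFun := h.toFun
  map_rel := h.map_rel
  map_const c := h.map_const (Sum.inl c)

/-- A term of the original language, viewed in the expanded one. -/
def LTerm.lift (hM : IsLocal M) (A : ParamSet M) {α : Type} {σ : α → L.Sorts} :
    {s : L.Sorts} → LTerm L α σ s → LTerm (L.withParams M hM A) α σ s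
  | _, .var a => LTerm.var (L := L.withParams M hM A) a
  | s, .const c => LTerm.const (L := L.withParams M hM A) (s := s) (Sum.inl c)

/-- A positive formula of the original language, viewed in the expanded one. -/
def PosForm.lift (hM : IsLocal M) (A : ParamSet M) : {α : Type} → {σ : α → L.Sorts} →
    PosForm L α σ → PosForm (L.withParams M hM A) α σ
  | _, _, .rel R ts => .rel (L := L.withParams M hM A) R fun i => (ts i).lift hM A
  | _, _, .and φ ψ => .and (φ.lift hM A) (ψ.lift hM A)
  | _, _, .or φ ψ => .or (φ.lift hM A) (ψ.lift hM A)
  | _, _, .ex s φ => .ex (L := L.withParams M hM A) s (φ.lift hM A)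

theorem LTerm.realize_lift (N : LStructure (L.withParams M hM A)) {α : Type} {σ : α → L.Sorts}
    {s : L.Sorts} (t : LTerm L α σ s) (v : (a : α) → N.Dom (σ a)) :
    (t.lift hM A).realize N v = t.realize (paramReduct N) v := by
  cases t <;> rfl

theorem PosForm.realize_lift (N : LStructure (L.withParams M hM A)) {α : Type} {σ : α → L.Sorts}
    (φ : PosForm L α σ) (v : (a : α) → N.Dom (σ a)) :
    (φ.lift hM A).Realize N v ↔ φ.Realize (paramReduct N) v := by
  induction φ with
  | rel R ts =>
    exact iff_of_eq (congrArg (N.relMap (L := L.withParams M hM A) R)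
      (funext fun i => (ts i).realize_lift N v))
  | and φ ψ ih₁ ih₂ => exact and_congr (ih₁ v) (ih₂ v)
  | or φ ψ ih₁ ih₂ => exact or_congr (ih₁ v) (ih₂ v)
  | ex s φ ih => exact exists_congr fun x => ih _

/-- The expansion of a structure by an interpretation of the parameters. -/
def paramExpand (hM : IsLocal M) (N : LStructure L) (k : ∀ s, A s → N.Dom s) :
    LStructure (L.withParams M hM A) where
  Dom := N.Dom
  relMap := N.relMap
  constMap {s} c := Sum.elim N.constMap (k s) c

theorem paramExpand_self : paramExpand hM M (fun s (a : A s) => a.1) = M.withParams hM A := by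
  refine congrArg (LStructure.mk (L := L.withParams M hM A) M.Dom M.relMap) ?_
  funext s c
  cases c <;> rfl

/-- Replacement of the variables and parameters of a term by terms of the original language. -/
def LTerm.dropParams {α β : Type} {σ : α → L.Sorts} {τ : β → L.Sorts}
    (θ : (a : α) → LTerm L β τ (σ a)) (π : ∀ s, A s → LTerm L β τ s) :
    {s : L.Sorts} → LTerm (L.withParams M hM A) α σ s → LTerm L β τ s
  | _, .var a => θ a
  | _, .const (.inl c) => .const c
  | s, .const (.inr a) => π s a

/-- Replacement of the variables and parameters of a positive formula by terms of the original
language. -/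
def PosForm.dropParams : {α : Type} → {σ : α → L.Sorts} → PosForm (L.withParams M hM A) α σ →
    {β : Type} → {τ : β → L.Sorts} → ((a : α) → LTerm L β τ (σ a)) →
    (∀ s, A s → LTerm L β τ s) → PosForm L β τ
  | _, _, .rel R ts, _, _, θ, π => .rel (L := L) R fun i => (ts i).dropParams θ π
  | _, _, .and φ ψ, _, _, θ, π => .and (φ.dropParams θ π) (ψ.dropParams θ π)
  | _, _, .or φ ψ, _, _, θ, π => .or (φ.dropParams θ π) (ψ.dropParams θ π)
  | _, _, .ex s φ, _, _, θ, π =>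
      .ex (L := L) s (φ.dropParams (substCons (L := L) s θ) fun r a => (π r a).weaken (L := L) s)

theorem LTerm.realize_dropParams (N : LStructure L) {α β : Type} {σ : α → L.Sorts}
    {τ : β → L.Sorts} (θ : (a : α) → LTerm L β τ (σ a)) (π : ∀ s, A s → LTerm L β τ s)
    (w : (b : β) → N.Dom (τ b)) :
    ∀ {s : L.Sorts} (t : LTerm (L.withParams M hM A) α σ s), (t.dropParams θ π).realize N w =
      t.realize (L := L.withParams M hM A) (paramExpand hM N fun s a => (π s a).realize N w)
        (fun a => (θ a).realize N w)
  | _, .var _ => rfl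
  | _, .const (.inl _) => rfl
  | _, .const (.inr _) => rfl

theorem PosForm.realize_dropParams (N : LStructure L) :
    ∀ {α : Type} {σ : α → L.Sorts} (φ : PosForm (L.withParams M hM A) α σ) {β : Type}
      {τ : β → L.Sorts} (θ : (a : α) → LTerm L β τ (σ a)) (π : ∀ s, A s → LTerm L β τ s)
      (w : (b : β) → N.Dom (τ b)),
      (φ.dropParams θ π).Realize N w ↔ φ.Realize (L := L.withParams M hM A)
        (paramExpand hM N fun s a => (π s a).realize N w) (fun a => (θ a).realize N w)
  | _, _, .rel R ts, _, _, θ, π, w =>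
    iff_of_eq (congrArg (N.relMap (L := L) R)
      (funext fun i => (ts i).realize_dropParams N θ π w))
  | _, _, .and φ ψ, _, _, θ, π, w =>
    and_congr (φ.realize_dropParams N θ π w) (ψ.realize_dropParams N θ π w)
  | _, _, .or φ ψ, _, _, θ, π, w =>
    or_congr (φ.realize_dropParams N θ π w) (ψ.realize_dropParams N θ π w)
  | _, _, .ex s φ, _, _, θ, π, w => exists_congr fun x => by
    refine (φ.realize_dropParams N _ _ (vcons x w)).trans ?_
    have h₂ : (fun r (a : A r) => ((π r a).weaken (L := L) s).realize N (vcons x w)) =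
        fun r a => (π r a).realize N w :=
      funext fun r => funext fun a => (π r a).realize_weaken N x w
    rw [h₂]
    exact iff_of_eq (congrArg (φ.Realize _) (realize_substCons (L := L) N θ x w))

theorem card_withParams_lt {κ : Cardinal} (hκ : L.card < κ)
    (hA : Cardinal.mk (Σ s : L.Sorts, A s) < κ) : (L.withParams M hM A).card < κ := by
  have h₀ : Cardinal.aleph0 ≤ κ := (le_max_left _ _).trans hκ.le
  have h := (le_max_right Cardinal.aleph0 _).trans_lt hκ
  refine max_lt ((le_max_left _ _).trans_lt hκ) ?_
  refine lt_of_le_of_lt (Cardinal.mk_le_of_surjective (f := Sum.elim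
    (β := L.Sorts ⊕ (Σ s : L.Sorts, L.Const s) ⊕ (Σ s : L.Sorts, L.Loc s) ⊕
      (Σ (n : ℕ) (ρ : Fin n → L.Sorts), L.Rel n ρ)) (α := Σ s : L.Sorts, A s)
      (fun p => Sum.inr (Sum.inl ⟨p.1, Sum.inr p.2⟩))
      (Sum.map id (Sum.map (fun p => ⟨p.1, Sum.inl p.2⟩) id))) ?_) ?_
  · rintro (s | ⟨s, c | c⟩ | x)
    · exact ⟨.inr (.inl s), rfl⟩
    · exact ⟨.inr (.inr (.inl ⟨s, c⟩)), rfl⟩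
    · exact ⟨.inl ⟨s, c⟩, rfl⟩
    · exact ⟨.inr (.inr (.inr x)), rfl⟩
  · rw [Cardinal.mk_sum, Cardinal.lift_id, Cardinal.lift_id]
    exact Cardinal.add_lt_of_lt h₀ hA h

end Parameters

/-! ## Saturation and ultrahomogeneity -/

section Saturation

variable {L : LocalLanguage}

theorem LHom.ext_toFun {M N : LStructure L} {f g : LHom M N}
    (h : ∀ s x, f.toFun s x = g.toFun s x) : f = g := by
  cases f
  cases g
  congr
  exact funext fun s => funext (h s)

theorem Substruct.locRel_toStruct {P : LStructure L} (B : Substruct P) {s : L.Sorts}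
    {d : L.Loc s} {a b : B.toStruct.Dom s} : B.toStruct.locRel d a b ↔ P.locRel d a.1 b.1 :=
  iff_of_eq (congrArg (P.relMap (L.locToRel d)) (dpair_map
    (C := fun k => B.toStruct.Dom (![s, s] k)) (D := fun k => P.Dom (![s, s] k))
    (fun _ z => z.1) a b))

theorem Substruct.isLocal_toStruct {P : LStructure L} (hP : IsLocal P) (B : Substruct P) :
    IsLocal B.toStruct where
  symm d _ _ h := B.locRel_toStruct.2 (hP.symm d _ _ (B.locRel_toStruct.1 h))
  mono d₁ d₂ hd _ _ h := B.locRel_toStruct.2 (hP.mono d₁ d₂ hd _ _ (B.locRel_toStruct.1 h))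
  comp d₁ d₂ _ _ _ h₁ h₂ := B.locRel_toStruct.2
    (hP.comp d₁ d₂ _ _ _ (B.locRel_toStruct.1 h₁) (B.locRel_toStruct.1 h₂))
  boundAx c₁ c₂ := B.locRel_toStruct.2 (hP.boundAx c₁ c₂)
  total a b := (hP.total a.1 b.1).imp fun _ h => B.locRel_toStruct.2 h
  dd0_eq _ _ := B.locRel_toStruct.trans ((hP.dd0_eq _ _).trans Subtype.ext_iff.symm)

theorem localModel_paramReduct {T : Set (PosSentence L)} {M : LStructure L} {hM : LocalModel M T}
    {A : ParamSet M} {P : LStructure (L.withParams M hM.1 A)}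
    (hP : LocalModel P (ThNeg (M.withParams hM.1 A))) : LocalModel (paramReduct P) T := by
  refine ⟨@IsLocal.paramReduct L M hM.1 A P hP.1, fun φ hφ h => hM.2 φ hφ ?_⟩
  have h₁ := (φ.realize_lift (hM := hM.1) (A := A) P fun e : Empty => e.elim).2 h
  exact (φ.realize_lift (hM := hM.1) (A := A) (M.withParams hM.1 A) fun e : Empty => e.elim).1
    (hP.realizedIn_of_thNeg (φ := φ.lift hM.1 A) h₁)

theorem Substruct.localModel_toStruct {T : Set (PosSentence L)} {P : LStructure L}
    (hP : LocalModel P T) {B : Substruct P}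
    (hB : ∀ (α : Type) (σ : α → L.Sorts) (φ : PosForm L α σ) (v : (a : α) → B.toStruct.Dom (σ a)),
      φ.Realize P (fun a => (v a).1) ↔ φ.Realize B.toStruct v) : LocalModel B.toStruct T := by
  refine ⟨B.isLocal_toStruct hP.1, fun φ hφ h => hP.2 φ hφ ?_⟩
  have := (hB _ _ φ _).2 h
  rwa [Subsingleton.elim (fun e : Empty => _) (fun e : Empty => e.elim)] at this

theorem IsUltrahomogeneous.isSaturatedAt {T : Set (PosSentence L)} {κ : Cardinal}
    (hκ : L.card < κ) {M : LStructure L} (hM : LocalModel M T) (hU : IsUltrahomogeneous T M κ) :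
    IsSaturatedAt M hM.1 κ := by
  rintro A hA hLJ α σ hα Γ ⟨⟨N, v, hN, hv⟩, -⟩
  have h₀ : Cardinal.aleph0 ≤ κ := (le_max_left _ _).trans hκ.le
  have hκ' : (L.withParams M hM.1 A).card < κ := card_withParams_lt hκ hA
  have hM' : LocalModel (M.withParams hM.1 A) (ThNeg (M.withParams hM.1 A)) :=
    ⟨isLocal_withParams, fun _ h => h⟩
  obtain ⟨P, hP, ⟨f⟩, ⟨g⟩⟩ := hLJ _ _ hM' hN
  obtain ⟨M₀, -, hM₀card, hM₀⟩ := exists_small_positive_substruct hM'.1 hκ' ∅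
    (by rw [Cardinal.mk_eq_zero]; exact Cardinal.aleph0_pos.trans_le h₀)
  obtain ⟨B, hBmem, hBcard, hB⟩ := exists_small_positive_substruct hP.1 hκ'
    (Set.range (fun p : Σ s, M₀.toStruct.Dom s => (⟨p.1, f.toFun _ p.2.1⟩ : Σ s, P.Dom s)) ∪
      Set.range (fun a => (⟨σ a, g.toFun _ (v a)⟩ : Σ s, P.Dom s)))
    ((Cardinal.mk_union_le _ _).trans_lt (Cardinal.add_lt_of_lt h₀
      (Cardinal.mk_range_le.trans_lt hM₀card) (Cardinal.mk_range_le.trans_lt hα)))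
  let e : LHom (paramReduct M₀.toStruct) M :=
    { toFun := fun s x => x.1
      map_rel := fun R x h => h
      map_const := fun c => rfl }
  have he : e.IsPosEmbedding := fun α σ φ x h =>
    (φ.realize_lift M₀.toStruct x).1 ((hM₀ α σ (φ.lift hM.1 A) x).1
      ((φ.realize_lift (M.withParams hM.1 A) _).2 h))
  let k : LHom M₀.toStruct B.toStruct :=
    { toFun := fun s x => ⟨f.toFun s x.1, hBmem ⟨s, _⟩ (Or.inl ⟨⟨s, x⟩, rfl⟩)⟩
      map_rel := fun R x h => f.map_rel R _ h
      map_const := fun c => Subtype.ext (f.map_const c) }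
  obtain ⟨h, hh⟩ := hU _ _
    (localModel_paramReduct (hM := hM) (Substruct.localModel_toStruct hM' hM₀))
    (localModel_paramReduct (hM := hM) (Substruct.localModel_toStruct hP hB))
    hM₀card hBcard e he k.paramReduct
  let h' : LHom B.toStruct (M.withParams hM.1 A) :=
    { toFun := h.toFun
      map_rel := h.map_rel
      map_const := fun {s} c => by
        have h₁ := congrFun (congrFun (congrArg LHom.toFun hh) s) (M₀.toStruct.constMap c)
        exact (congrArg (h.toFun s) (k.map_const c).symm).trans h₁ }
  let w : (a : α) → B.toStruct.Dom (σ a) := fun a =>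
    ⟨g.toFun _ (v a), hBmem ⟨σ a, _⟩ (Or.inr ⟨a, rfl⟩)⟩
  refine ⟨fun a => h'.toFun _ (w a), fun φ hφ => ?_⟩
  refine (φ.realize_toPosForm _ _).1 (h'.realize_posForm _ w ((hB _ _ _ w).1 ?_))
  exact g.realize_posForm _ v ((φ.realize_toPosForm _ _).2 (hv φ hφ))

theorem LHom.IsPosEmbedding.injective {M N : LStructure L} (hM : IsLocal M) (hN : IsLocal N)
    {f : LHom M N} (hf : f.IsPosEmbedding) {s : L.Sorts} {x y : M.Dom s}
    (h : f.toFun s x = f.toFun s y) : x = y :=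
  (realize_eqForm hM _ _ _).1 (hf Bool (fun _ => s) (eqForm (.var true) (.var false))
    (fun b => cond b x y) ((realize_eqForm hN _ _ _).2 h))

theorem LHom.IsPosEmbedding.nonempty {M N : LStructure L} (hM : IsLocal M) (hN : IsLocal N)
    {f : LHom M N} (hf : f.IsPosEmbedding) {s : L.Sorts} (x : N.Dom s) : Nonempty (M.Dom s) :=
  (realize_nonemptyForm hM _).1 (hf Empty (emptySorts L) (nonemptyForm s) (fun e => e.elim)
    ((realize_nonemptyForm hN _).2 ⟨x⟩))

/-- A positive embedding into `M` and a homomorphism into `B` can be amalgamated. -/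
theorem LHom.IsPosEmbedding.exists_amalgam {A B M : LStructure L} (hA : IsLocal A)
    (hB : IsLocal B) (hM : IsLocal M) {f : LHom A M} (hf : f.IsPosEmbedding) (g : LHom A B) :
    ∃ P : LStructure L, LocalModel P (ThNeg B) ∧ ∃ (i : LHom B P) (j : LHom M P),
      ∀ s a, j.toFun s (f.toFun s a) = i.toFun s (g.toFun s a) := by
  obtain ⟨P, hP, i, j, hij⟩ := _root_.exists_amalgam hM hB
    (fun p : Σ s, A.Dom s => f.toFun p.1 p.2) (fun p => g.toFun p.1 p.2)
    (fun s x => ⟨⟨s, (hf.nonempty hA hM x).some⟩, rfl⟩) (fun F => by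
      obtain ⟨H, hH, hHF⟩ := exists_map_preserving (D := A)
        (fun p : Σ s, A.Dom s => f.toFun p.1 p.2) (by
          rintro ⟨s, x⟩ ⟨t, y⟩ h
          obtain ⟨rfl, h⟩ := Sigma.mk.inj h
          exact congrArg (Sigma.mk s) (hf.injective hA hM (eq_of_heq h)))
        (fun p => p.2) (fun s x => hf.nonempty hA hM x) (fun φ h => hf _ _ φ _ h) F
      refine ⟨fun s x => g.toFun s (H s x), fun p => congrArg _ (hH p), fun {s} c => ?_,
        fun p hp h => g.map_rel _ _ (hHF p hp h)⟩
      rw [← f.map_const]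
      exact (congrArg (g.toFun s) (hH ⟨s, A.constMap c⟩)).trans (g.map_const c))
  exact ⟨P, hP, i, j, fun s a => hij ⟨s, a⟩⟩

theorem LHom.IsPosEmbedding.localModel_paramExpand {M P : LStructure L} (hM : IsLocal M)
    (hP : IsLocal P) {j : LHom M P} (hj : j.IsPosEmbedding) (A : ParamSet M) :
    LocalModel (paramExpand hM P fun s (a : A s) => j.toFun s a.1)
      (ThNeg (M.withParams hM A)) := by
  have hc : ∀ {s} (c : L.Const s ⊕ A s),
      (paramExpand hM P fun s (a : A s) => j.toFun s a.1).constMap (s := s) c =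
        j.toFun s (paramInterp M A c) := by
    rintro s (c | c)
    · exact (j.map_const c).symm
    · rfl
  refine ⟨⟨hP.symm, hP.mono, hP.comp, fun {s} c₁ c₂ => ?_, hP.total, hP.dd0_eq⟩,
    fun φ hφ h => hφ ?_⟩
  · exact Eq.mpr (congrArg₂ (P.locRel ((L.withParams M hM A).bound c₁ c₂)) (hc c₁) (hc c₂)) <|
      j.map_locRel ((isLocal_withParams (hM := hM) (A := A)).boundAx c₁ c₂)
  · let ψ := φ.dropParams (β := Σ s, A s) (τ := Sigma.fst) (fun e => e.elim)
      (fun s a => .var (σ := Sigma.fst) ⟨s, a⟩)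
    have h₁ : ψ.Realize P fun b => j.toFun _ b.2.1 :=
      (φ.realize_dropParams P _ _ _).2
        ((iff_of_eq (congrArg (φ.Realize _) (funext fun e => e.elim))).1 h)
    have h₂ := (φ.realize_dropParams M _ _ _).1 (hj _ _ ψ (fun b => b.2.1) h₁)
    have h₃ : φ.Realize (paramExpand hM M fun s (a : A s) => a.1) fun e => e.elim :=
      (iff_of_eq (congrArg (φ.Realize _) (funext fun e => e.elim))).1 h₂
    exact (iff_of_eq (congrArg (PosSentence.RealizedIn φ) paramExpand_self)).1 h₃

theorem IsSaturatedAt.isUltrahomogeneous {T : Set (PosSentence L)} {κ : Cardinal}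
    {M : LStructure L} (hM : IsPC M T) (hS : IsSaturatedAt M hM.1.1 κ) :
    IsUltrahomogeneous T M κ := by
  intro A B hA hB hAκ hBκ f hf g
  obtain ⟨P, hP, i, j, hij⟩ := hf.exists_amalgam hA.1 hB.1 hM.1.1 g
  have hj : j.IsPosEmbedding := hM.2 P j
    ⟨hP.1, fun φ hφ h => hB.2 φ hφ (hP.realizedIn_of_thNeg h)⟩
  let R : ParamSet M := fun s => Set.range (f.toFun s)
  let c : ∀ {s}, A.Dom s → (L.withParams M hM.1.1 R).Const s := fun a => Sum.inr ⟨_, a, rfl⟩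
  have hP' := hj.localModel_paramExpand hM.1.1 hP.1 R
  have hR : Cardinal.mk (Σ s, R s) < κ := by
    refine lt_of_le_of_lt (Cardinal.mk_le_of_surjective
      (f := fun p : Σ s, A.Dom s => (⟨p.1, f.toFun _ p.2, p.2, rfl⟩ : Σ s, R s)) ?_) hAκ
    rintro ⟨s, _, a, rfl⟩
    exact ⟨⟨s, a⟩, rfl⟩
  obtain ⟨Γ, hΓ, hmax⟩ := IsPartialLType.exists_isLType
    (Γ := ltp (paramExpand hM.1.1 P fun s (a : R s) => j.toFun s a.1)
      (fun b : Σ s, B.Dom s => i.toFun b.1 b.2)) ⟨_, _, hP', fun φ hφ => hφ⟩ (by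
      rintro ⟨s, b⟩
      obtain ⟨x⟩ := hj.nonempty hM.1.1 hP.1 (i.toFun s b)
      obtain ⟨a⟩ := hf.nonempty hA.1 hM.1.1 x
      obtain ⟨d, hd⟩ := hP.1.total (i.toFun s b) (j.toFun s (f.toFun s a))
      exact ⟨d, c a, (realize_locToRel_tpair _ _ _).2 hd⟩)
  obtain ⟨u, hu⟩ := hS R hR (hasLJP_thNeg isLocal_withParams fun s x =>
    (hf.nonempty hA.1 hM.1.1 x).map c) _ _ hBκ Γ hmax
  let y : ∀ {s} (b : B.Dom s), LTerm (L.withParams M hM.1.1 R)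
      (Σ s, B.Dom s) (fun b => b.1) s :=
    fun {s} b => LTerm.var (L := L.withParams M hM.1.1 R) (α := Σ s, B.Dom s)
      (σ := fun b => b.1) ⟨s, b⟩
  have heq : ∀ {s} (b : B.Dom s) (k : (L.withParams M hM.1.1 R).Const s),
      i.toFun s b = (paramExpand hM.1.1 P fun s (a : R s) => j.toFun s a.1).constMap k →
      u ⟨s, b⟩ = paramInterp M R k := by
    intro s b k h
    have := hu (.rel (L.locToRel (L.dd0 s)) (tpair (y b) (.const k)))
      (hΓ ((realize_locToRel_tpair _ _ _).2 ((hP'.1.dd0_eq _ _).2 h)))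
    exact (hM.1.1.dd0_eq _ _).1 ((realize_locToRel_tpair _ _ _).1 this)
  let h : LHom B M :=
    { toFun := fun s b => u ⟨s, b⟩
      map_rel := fun {n ρ} S x hx =>
        hu (.rel (L := L.withParams M hM.1.1 R) S fun k => y (x k))
          (@hΓ (.rel (L := L.withParams M hM.1.1 R) S fun k => y (x k)) (i.map_rel S x hx))
      map_const := fun k => heq _ (Sum.inl k) (i.map_const k) }
  exact ⟨h, LHom.ext_toFun fun s a => heq _ (c a) (hij s a).symm⟩

end Saturation

/-- For `κ > |L|`: every κ-ultrahomogeneous local model of `T` is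
κ-saturated, and every κ-saturated local positively closed model of `T` is
κ-ultrahomogeneous for `T`. -/
theorem ultrahomogeneous_iff_saturated
    {L : LocalLanguage} (T : Set (PosSentence L))
    (hT : IsNegLocalTheory T) (hsat : LocSat T)
    (κ : Cardinal) (hκ : L.card < κ) :
    (∀ (M : LStructure L) (hM : LocalModel M T),
        IsUltrahomogeneous T M κ → IsSaturatedAt M hM.1 κ) ∧
    (∀ (M : LStructure L) (hM : IsPC M T),
        IsSaturatedAt M hM.1.1 κ → IsUltrahomogeneous T M κ) :=
  ⟨fun _ hM hU => hU.isSaturatedAt hκ hM, fun _ hM hS => hS.isUltrahomogeneous hM⟩
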